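/- Let f : [0,1] → {1,2,…} ∪ {ω, 𝔠}. There exists a continuous function F : [0,1] → [0,1] with F(0) = 0, F(1) = 1 whose indicatrix is f if and only if: (i) Condition (1) holds for f; (ii) Condition (**) holds for f at every y with f(y) = ω, and there is a countable set S ⊆ {y : f(y) = 𝔠} such that Condition (**) holds for f at every y with f(y) = 𝔠 and y ∉ S; (iii) the set {y ∈ [0,1] : f(y) = 𝔠} is analytic. -/

import Mathlib

open Set Cardinal

noncomputable section

/-- The section of `F` over `y`: the set of `x ∈ [0,1]` with `F x = y`. -/
def Sec (F : ℝ → ℝ) (y : ℝ) : Set ℝ := {x | x ∈ Set.Icc (0:ℝ) 1 ∧ F x = y}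

/-- Condition (1) for a cardinal-valued function `f` on `[0,1]`. -/
def Cond1 (f : ℝ → Cardinal) : Prop :=
  (∀ y ∈ Set.Ioo (0:ℝ) 1, f y < ℵ₀ →
    ∃ ε > 0, ∀ y₁ ∈ Set.Icc (0:ℝ) 1, ∀ y₂ ∈ Set.Icc (0:ℝ) 1,
      y - ε < y₁ → y₁ < y → y < y₂ → y₂ < y + ε →
      2 * f y ≤ f y₁ + f y₂ ∧
      (f y₁ + f y₂ = 2 * f y →
        (∃ k : ℕ, f y₁ = k ∧ Odd k) ∧ (∃ k : ℕ, f y₂ = k ∧ Odd k))) ∧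
  (f 0 < ℵ₀ → ∃ ε > 0, ∀ y₂ ∈ Set.Icc (0:ℝ) 1, 0 < y₂ → y₂ < ε →
    2 * f 0 ≤ 1 + f y₂) ∧
  (f 1 < ℵ₀ → ∃ ε > 0, ∀ y₁ ∈ Set.Icc (0:ℝ) 1, 1 - ε < y₁ → y₁ < 1 →
    2 * f 1 ≤ f y₁ + 1)

/-- Condition (**) for a cardinal-valued function `f` at the point `y ∈ [0,1]`,
with the convention that the term `f y₁` is replaced by `1` when `y = 0` and
the term `f y₂` is replaced by `1` when `y = 1`. -/
def CondStar (f : ℝ → Cardinal) (y : ℝ) : Prop :=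
  ∀ n : ℕ, ∃ ε > 0,
    (∀ y₁ ∈ Set.Icc (0:ℝ) 1, ∀ y₂ ∈ Set.Icc (0:ℝ) 1,
      y - ε < y₁ → y₁ < y → y < y₂ → y₂ < y + ε → (n : Cardinal) ≤ f y₁ + f y₂) ∧
    (y = 0 → ∀ y₂ ∈ Set.Icc (0:ℝ) 1, 0 < y₂ → y₂ < ε → (n : Cardinal) ≤ 1 + f y₂) ∧
    (y = 1 → ∀ y₁ ∈ Set.Icc (0:ℝ) 1, 1 - ε < y₁ → y₁ < 1 → (n : Cardinal) ≤ f y₁ + 1)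

lemma gapA (G : ℝ → ℝ) (hG : ContinuousOn G (Icc 0 1)) (k : ℕ) (x : Fin (k+1) → ℝ)
    (hxm : StrictMono x) (y : ℝ) (hx : ∀ i, x i ∈ Icc (0:ℝ) 1 ∧ G (x i) = y)
    (c : Fin k → ℝ) (hc : ∀ j, c j ∈ Ioo (x j.castSucc) (x j.succ)) (N : Finset (Fin k))
    (y₁ : ℝ) (hy : y₁ < y) (hN : ∀ j ∈ N, G (c j) < y₁) :
    ((2 * N.card : ℕ) : Cardinal) ≤ #{t | t ∈ Ioo (x 0) (x (Fin.last k)) ∧ G t = y₁} := by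
  have h0 : ∀ j : N, ∃ t ∈ Ioo (x j.1.castSucc) (c j.1), G t = y₁ := by
    intro j
    have := intermediate_value_Ioo' (hc j.1).1.le (f := G) (hG.mono (Icc_subset_Icc (hx _).1.1
      ((hc j.1).2.le.trans (hx _).1.2)))
    obtain ⟨t, ht, h⟩ := this (show y₁ ∈ _ from ⟨hN _ j.2, by rw [(hx _).2]; exact hy⟩)
    exact ⟨t, ht, h⟩
  have h1 : ∀ j : N, ∃ t ∈ Ioo (c j.1) (x j.1.succ), G t = y₁ := by
    intro j
    have := intermediate_value_Ioo (hc j.1).2.le (f := G) (hG.mono (Icc_subset_Icc ((hx _).1.1.trans (hc j.1).1.le)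
      (hx _).1.2))
    obtain ⟨t, ht, h⟩ := this (show y₁ ∈ _ from ⟨hN _ j.2, by rw [(hx _).2]; exact hy⟩)
    exact ⟨t, ht, h⟩
  choose t0 ht0 he0 using h0
  choose t1 ht1 he1 using h1
  let g : N × Bool → ℝ := fun p => if p.2 then t1 p.1 else t0 p.1
  have hg : ∀ p : N × Bool, g p ∈ Ioo (x p.1.1.castSucc) (x p.1.1.succ) ∧ G (g p) = y₁ := by
    rintro ⟨j, b⟩
    have := hc j.1
    cases b
    · exact ⟨⟨(ht0 j).1, (ht0 j).2.trans this.2⟩, he0 j⟩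
    · exact ⟨⟨this.1.trans (ht1 j).1, (ht1 j).2⟩, he1 j⟩
  have hlt : ∀ p q : N × Bool, p.1.1 < q.1.1 → g p < g q := by
    intro p q h
    have : x p.1.1.succ ≤ x q.1.1.castSucc := hxm.monotone (by
      rw [Fin.le_def]; simpa using h)
    exact ((hg p).1.2.trans_le this).trans (hg q).1.1
  have hinj : Function.Injective g := by
    rintro p q h
    have : p.1 = q.1 := by
      rcases lt_trichotomy p.1.1 q.1.1 with h' | h' | h'
      · exact absurd h (hlt _ _ h').ne
      · exact Subtype.ext h'
      · exact absurd h (hlt _ _ h').ne'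
    obtain ⟨j, b⟩ := p
    obtain ⟨j', b'⟩ := q
    simp only at this
    subst this
    have hh : t0 j < t1 j := (ht0 j).2.trans (ht1 j).1
    cases b <;> cases b'
    · rfl
    · exact absurd h hh.ne
    · exact absurd h hh.ne'
    · rfl
  have := Cardinal.mk_le_of_injective (α := N × Bool)
    (β := {t | t ∈ Ioo (x 0) (x (Fin.last k)) ∧ G t = y₁})
    (f := fun p => ⟨g p, ⟨(hxm.monotone (Fin.zero_le _)).trans_lt (hg p).1.1,
      (hg p).1.2.trans_le (hxm.monotone (Fin.le_last _))⟩, (hg p).2⟩)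
    (fun p q h => hinj (congrArg Subtype.val h))
  refine le_trans (le_of_eq ?_) this
  simp [mul_comm]

def NoInt (F : ℝ → ℝ) (y : ℝ) : Prop := ∀ u v : ℝ, u < v → ¬ Icc u v ⊆ Sec F y

lemma gapB (F : ℝ → ℝ) (hF : ContinuousOn F (Icc 0 1)) (hm : MapsTo F (Icc 0 1) (Icc 0 1))
    (h0 : F 0 = 0) (h1 : F 1 = 1) (y : ℝ) (hn : NoInt F y) (k : ℕ)
    (hk : ((k + 1 : ℕ) : Cardinal) ≤ #(Sec F y)) :
    ∃ p q : ℕ, p + q = k ∧ (y = 0 → p = 0) ∧ (y = 1 → q = 0) ∧ ∃ ε > 0,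
      (∀ y₁ ∈ Icc (0:ℝ) 1, y - ε < y₁ → y₁ < y → ((1 + 2 * p : ℕ) : Cardinal) ≤ #(Sec F y₁)) ∧
      (∀ y₂ ∈ Icc (0:ℝ) 1, y < y₂ → y₂ < y + ε → ((1 + 2 * q : ℕ) : Cardinal) ≤ #(Sec F y₂)) := by
  classical
  obtain ⟨T, hTs, hTc⟩ := Cardinal.le_mk_iff_exists_subset.1 hk
  have hfin : T.Finite := by
    rw [← Cardinal.lt_aleph0_iff_set_finite, hTc]; exact Cardinal.natCast_lt_aleph0
  have hcard : hfin.toFinset.card = k + 1 := by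
    have := Cardinal.mk_coe_finset (s := hfin.toFinset)
    have h2 : #(hfin.toFinset) = #T := by simp
    rw [h2, hTc] at this
    exact_mod_cast this.symm
  let x := hfin.toFinset.orderEmbOfFin hcard
  have hxS : ∀ i, x i ∈ Sec F y := fun i => hTs (by
    exact hfin.mem_toFinset.1 (hfin.toFinset.orderEmbOfFin_mem hcard i))
  have hxm : StrictMono x := x.strictMono
  have hc : ∀ j : Fin k, ∃ c ∈ Ioo (x j.castSucc) (x j.succ), F c ≠ y := by
    intro j
    have hlt : x j.castSucc < x j.succ := hxm (Fin.castSucc_lt_succ)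
    by_contra hcon
    push Not at hcon
    apply hn _ _ hlt
    intro t ht
    refine ⟨⟨(hxS _).1.1.trans ht.1, ht.2.trans (hxS _).1.2⟩, ?_⟩
    rcases eq_or_lt_of_le ht.1 with h | h
    · rw [← h]; exact (hxS _).2
    rcases eq_or_lt_of_le ht.2 with h' | h'
    · rw [h']; exact (hxS _).2
    exact hcon t ⟨h, h'⟩
  choose c hcm hcy using hc
  have hcI : ∀ j, c j ∈ Icc (0:ℝ) 1 := fun j =>
    ⟨(hxS _).1.1.trans (hcm j).1.le, (hcm j).2.le.trans (hxS _).1.2⟩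
  let N := Finset.univ.filter (fun j => F (c j) < y)
  let P := Finset.univ.filter (fun j => ¬ F (c j) < y)
  have hε : ∃ ε > 0, ∀ j, ε ≤ |F (c j) - y| := by
    have : ∀ s : Finset (Fin k), ∃ ε > 0, ∀ j ∈ s, ε ≤ |F (c j) - y| := by
      intro s
      induction s using Finset.induction_on with
      | empty => exact ⟨1, one_pos, by simp⟩
      | insert a s _ ih =>
        obtain ⟨ε, he, h⟩ := ih
        refine ⟨min ε |F (c a) - y|, lt_min he (abs_pos.2 (sub_ne_zero.2 (hcy a))), ?_⟩
        intro j hj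
        rcases Finset.mem_insert.1 hj with rfl | hj
        · exact min_le_right _ _
        · exact (min_le_left _ _).trans (h j hj)
    obtain ⟨ε, he, h⟩ := this Finset.univ
    exact ⟨ε, he, fun j => h j (Finset.mem_univ _)⟩
  obtain ⟨ε, he, hej⟩ := hε
  refine ⟨N.card, P.card, ?_, ?_, ?_, ε, he, ?_, ?_⟩
  · have := Finset.card_filter_add_card_filter_not (s := (Finset.univ : Finset (Fin k))) (fun j => F (c j) < y)
    rw [Finset.card_univ, Fintype.card_fin] at this
    exact this
  · intro hy
    rw [Finset.card_eq_zero, Finset.filter_eq_empty_iff]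
    intro j _
    rw [hy]; exact not_lt.2 (hm (hcI j)).1
  · intro hy
    rw [Finset.card_eq_zero, Finset.filter_eq_empty_iff]
    intro j _
    rw [not_not]
    refine lt_of_le_of_ne ?_ (hcy j)
    rw [hy]; exact (hm (hcI j)).2
  · intro y₁ hy1 hyl hyr
    have hA := gapA F hF k x hxm y (fun i => hxS i) c hcm N y₁ hyr (by
      intro j hj
      have hj' : F (c j) < y := (Finset.mem_filter.1 hj).2
      have := hej j
      rw [abs_of_neg (by linarith)] at this
      linarith)
    have := intermediate_value_Ico (hxS 0).1.1 (hF.mono (Icc_subset_Icc le_rfl (hxS 0).1.2))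
    obtain ⟨e, he1, he2⟩ := this (show y₁ ∈ Ico (F 0) (F (x 0)) by
      rw [h0, (hxS 0).2]; exact ⟨hy1.1, hyr⟩)
    have hsub : insert e {t | t ∈ Ioo (x 0) (x (Fin.last k)) ∧ F t = y₁} ⊆ Sec F y₁ := by
      rintro t (rfl | ⟨ht, ht2⟩)
      · exact ⟨⟨he1.1, he1.2.le.trans (hxS 0).1.2⟩, he2⟩
      · exact ⟨⟨(hxS _).1.1.trans ht.1.le, ht.2.le.trans (hxS _).1.2⟩, ht2⟩
    refine le_trans ?_ (Cardinal.mk_le_mk_of_subset hsub)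
    rw [Cardinal.mk_insert (by rintro ⟨h, -⟩; exact absurd h.1 (not_lt.2 he1.2.le))]
    rw [Nat.cast_add, add_comm]
    simpa using hA
  · intro y₂ hy1 hyl hyr
    have hA := gapA (fun t => - F t) hF.neg k x hxm (-y) (fun i => ⟨(hxS i).1, by rw [(hxS i).2]⟩)
      c hcm P (-y₂) (by linarith) (by
      intro j hj
      have hj' : ¬ F (c j) < y := (Finset.mem_filter.1 hj).2
      have := hej j
      rw [abs_of_nonneg (by linarith)] at this
      linarith)
    have := intermediate_value_Ioc (hxS (Fin.last k)).1.2 (hF.mono (Icc_subset_Icc (hxS (Fin.last k)).1.1 le_rfl))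
    obtain ⟨e, he1, he2⟩ := this (show y₂ ∈ Ioc (F (x (Fin.last k))) (F 1) by
      rw [h1, (hxS _).2]; exact ⟨hyl, hy1.2⟩)
    have hsub : insert e {t | t ∈ Ioo (x 0) (x (Fin.last k)) ∧ -F t = -y₂} ⊆ Sec F y₂ := by
      rintro t (rfl | ⟨ht, ht2⟩)
      · exact ⟨⟨(hxS _).1.1.trans he1.1.le, he1.2⟩, he2⟩
      · exact ⟨⟨(hxS _).1.1.trans ht.1.le, ht.2.le.trans (hxS _).1.2⟩, neg_injective ht2⟩
    refine le_trans ?_ (Cardinal.mk_le_mk_of_subset hsub)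
    rw [Cardinal.mk_insert (by rintro ⟨h, -⟩; exact absurd h.2 (not_lt.2 he1.1.le))]
    rw [Nat.cast_add, add_comm]
    simpa using hA

lemma noInt_of_le (F : ℝ → ℝ) (y : ℝ) (h : #(Sec F y) ≤ ℵ₀) : NoInt F y := by
  intro u v huv hs
  have h1 := Cardinal.mk_le_mk_of_subset hs
  rw [Cardinal.mk_Icc_real huv] at h1
  exact absurd (h1.trans h) (not_le.2 Cardinal.aleph0_lt_continuum)

lemma nec_cond1 (f : ℝ → Cardinal) (F : ℝ → ℝ) (hF : ContinuousOn F (Icc 0 1))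
    (hm : MapsTo F (Icc 0 1) (Icc 0 1)) (h0 : F 0 = 0) (h1 : F 1 = 1)
    (hf : ∀ y ∈ Icc (0:ℝ) 1, #(Sec F y) = f y) : Cond1 f := by
  have key : ∀ y ∈ Icc (0:ℝ) 1, f y < ℵ₀ → ∃ k : ℕ, f y = (k + 1 : ℕ) ∧ ∃ p q : ℕ, p + q = k ∧ (y = 0 → p = 0) ∧
      (y = 1 → q = 0) ∧ ∃ ε > 0,
      (∀ y₁ ∈ Icc (0:ℝ) 1, y - ε < y₁ → y₁ < y → ((1 + 2 * p : ℕ) : Cardinal) ≤ f y₁) ∧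
      (∀ y₂ ∈ Icc (0:ℝ) 1, y < y₂ → y₂ < y + ε → ((1 + 2 * q : ℕ) : Cardinal) ≤ f y₂) := by
    intro y hy hfy
    obtain ⟨n, hn⟩ := Cardinal.lt_aleph0.1 hfy
    have hne : n ≠ 0 := by
      rintro rfl
      have := hf y hy
      rw [hn, Nat.cast_zero, Cardinal.mk_eq_zero_iff] at this
      have hiv := intermediate_value_Icc (zero_le_one) hF
      rw [h0, h1] at hiv
      obtain ⟨x, hx, hxy⟩ := hiv hy
      exact this.elim ⟨x, hx, hxy⟩
    obtain ⟨k, rfl⟩ := Nat.exists_eq_succ_of_ne_zero hne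
    refine ⟨k, hn, ?_⟩
    obtain ⟨p, q, hpq, hp, hq, ε, he, hl, hr⟩ := gapB F hF hm h0 h1 y
      (noInt_of_le F y (by rw [hf y hy]; exact hfy.le)) k (by rw [hf y hy, hn])
    refine ⟨p, q, hpq, hp, hq, ε, he, ?_, ?_⟩
    · intro y₁ hy1 h h'; rw [← hf _ hy1]; exact hl _ hy1 h h'
    · intro y₁ hy1 h h'; rw [← hf _ hy1]; exact hr _ hy1 h h'
  refine ⟨?_, ?_, ?_⟩
  · intro y hy hfy
    obtain ⟨k, hk, p, q, hpq, -, -, ε, he, hl, hr⟩ := key y ⟨hy.1.le, hy.2.le⟩ hfy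
    refine ⟨ε, he, ?_⟩
    intro y₁ hy1 y₂ hy2 ha hb hc hd
    have A := hl _ hy1 ha hb
    have B := hr _ hy2 hc hd
    have e : (2 : Cardinal) * f y = ((1 + 2 * p + (1 + 2 * q) : ℕ) : Cardinal) := by
      rw [hk]; have : 1 + 2 * p + (1 + 2 * q) = 2 * (k+1) := by omega
      rw [this]; push_cast; ring
    rw [e]
    constructor
    · rw [Nat.cast_add]; exact add_le_add A B
    · intro heq
      have hlt : f y₁ + f y₂ < ℵ₀ := by rw [heq]; exact Cardinal.natCast_lt_aleph0
      obtain ⟨n1, hn1⟩ := Cardinal.lt_aleph0.1 (lt_of_le_of_lt (self_le_add_right _ _) hlt)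
      obtain ⟨n2, hn2⟩ := Cardinal.lt_aleph0.1 (lt_of_le_of_lt (self_le_add_left _ _) hlt)
      rw [hn1] at A heq
      rw [hn2] at B heq
      rw [← Nat.cast_add] at heq
      have A' : 1 + 2 * p ≤ n1 := by exact_mod_cast A
      have B' : 1 + 2 * q ≤ n2 := by exact_mod_cast B
      have C' : n1 + n2 = 1 + 2 * p + (1 + 2 * q) := by exact_mod_cast heq
      exact ⟨⟨n1, hn1, ⟨p, by omega⟩⟩, ⟨n2, hn2, ⟨q, by omega⟩⟩⟩
  · intro hfy
    obtain ⟨k, hk, p, q, hpq, hp, -, ε, he, hl, hr⟩ := key 0 ⟨le_rfl, zero_le_one⟩ hfy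
    refine ⟨ε, he, fun y₂ hy2 ha hb => ?_⟩
    have := hr _ hy2 ha (by linarith)
    have h2 : q = k := by have := hp rfl; omega
    subst h2
    calc 2 * f 0 = 1 + ((1 + 2 * q : ℕ) : Cardinal) := by rw [hk]; push_cast; ring
      _ ≤ _ := by gcongr
  · intro hfy
    obtain ⟨k, hk, p, q, hpq, -, hq, ε, he, hl, hr⟩ := key 1 ⟨zero_le_one, le_rfl⟩ hfy
    refine ⟨ε, he, fun y₂ hy2 ha hb => ?_⟩
    have := hl _ hy2 ha hb
    have h2 : p = k := by have := hq rfl; omega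
    subst h2
    calc 2 * f 1 = ((1 + 2 * p : ℕ) : Cardinal) + 1 := by rw [hk]; push_cast; ring
      _ ≤ _ := by gcongr

lemma nec_star (f : ℝ → Cardinal) (F : ℝ → ℝ) (hF : ContinuousOn F (Icc 0 1))
    (hm : MapsTo F (Icc 0 1) (Icc 0 1)) (h0 : F 0 = 0) (h1 : F 1 = 1)
    (hf : ∀ y ∈ Icc (0:ℝ) 1, #(Sec F y) = f y) (y : ℝ) (hy : y ∈ Icc (0:ℝ) 1)
    (hinf : ℵ₀ ≤ f y) (hno : NoInt F y) : CondStar f y := by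
  intro n
  obtain ⟨p, q, hpq, hp, hq, ε, he, hl, hr⟩ := gapB F hF hm h0 h1 y hno n
    (by rw [hf y hy]; exact Cardinal.natCast_lt_aleph0.le.trans hinf)
  refine ⟨ε, he, ?_, ?_, ?_⟩
  · intro y₁ hy1 y₂ hy2 ha hb hc hd
    have A := hl _ hy1 ha hb
    have B := hr _ hy2 hc hd
    rw [hf _ hy1] at A
    rw [hf _ hy2] at B
    refine le_trans ?_ (add_le_add A B)
    have : n ≤ 1 + 2 * p + (1 + 2 * q) := by omega
    exact_mod_cast this
  · rintro rfl y₂ hy2 ha hb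
    have B := hr _ hy2 ha (by linarith)
    rw [hf _ hy2] at B
    refine le_trans ?_ (add_le_add le_rfl B)
    have := hp rfl
    have : n ≤ 1 + (1 + 2 * q) := by omega
    exact_mod_cast this
  · rintro rfl y₂ hy2 ha hb
    have B := hl _ hy2 ha hb
    rw [hf _ hy2] at B
    refine le_trans ?_ (add_le_add B le_rfl)
    have := hq rfl
    have : n ≤ (1 + 2 * p) + 1 := by omega
    exact_mod_cast this

lemma nec_S (F : ℝ → ℝ) : {y | ¬ NoInt F y}.Countable := by
  refine Set.Countable.mono ?_ ((Set.countable_range ((↑) : ℚ → ℝ)).image F)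
  intro y hy
  simp only [NoInt, mem_ofPred_eq, not_forall, not_not] at hy
  obtain ⟨u, v, huv, hs⟩ := hy
  obtain ⟨q, hq1, hq2⟩ := exists_rat_btwn huv
  exact ⟨q, ⟨q, rfl⟩, (hs ⟨hq1.le, hq2.le⟩).2⟩

lemma nec_analytic (F : ℝ → ℝ) (hF : ContinuousOn F (Icc 0 1)) :
    MeasureTheory.AnalyticSet {y | ¬ (Sec F y).Countable} := by
  let F' : ℝ → ℝ := fun x => F (projIcc (0:ℝ) 1 zero_le_one x)
  have hF' : Continuous F' := by
    have := hF.domRestrict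
    exact this.comp continuous_projIcc
  have hFF : ∀ x ∈ Icc (0:ℝ) 1, F' x = F x := by
    intro x hx; simp only [F']; rw [projIcc_of_mem _ hx]
  let D : Set (ℕ → ℝ) := {x | (∀ n, x n ∈ Icc (0:ℝ) 1) ∧ (∀ n, F' (x n) = F' (x 0)) ∧
    ∀ n k : ℕ, ∃ m, x m ≠ x n ∧ |x m - x n| < 1 / ((k:ℝ) + 1)}
  have hD : MeasurableSet D := by
    have e : D = (⋂ n, {x : ℕ → ℝ | x n ∈ Icc (0:ℝ) 1}) ∩ ((⋂ n, {x : ℕ → ℝ | F' (x n) = F' (x 0)}) ∩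
      ⋂ n, ⋂ k : ℕ, ⋃ m, ({x : ℕ → ℝ | x m = x n}ᶜ ∩ {x : ℕ → ℝ | |x m - x n| < 1 / ((k:ℝ) + 1)})) := by
      ext x; simp [D]
    rw [e]
    refine MeasurableSet.inter (MeasurableSet.iInter fun n => ?_) (MeasurableSet.inter
      (MeasurableSet.iInter fun n => ?_) (MeasurableSet.iInter fun n => MeasurableSet.iInter fun k =>
      MeasurableSet.iUnion fun m => MeasurableSet.inter (MeasurableSet.compl ?_) ?_))
    · exact (isClosed_Icc.preimage (continuous_apply n)).measurableSet
    · exact (isClosed_eq (hF'.comp (continuous_apply n)) (hF'.comp (continuous_apply 0))).measurableSet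
    · exact (isClosed_eq (continuous_apply m) (continuous_apply n)).measurableSet
    · exact (isOpen_lt (by fun_prop) continuous_const).measurableSet
  have himg : {y | ¬ (Sec F y).Countable} = (fun x : ℕ → ℝ => F' (x 0)) '' D := by
    ext y
    constructor
    · intro hy
      have hcl : IsClosed (Sec F y) := by
        have : Sec F y = Icc 0 1 ∩ F' ⁻¹' {y} := by
          ext x
          constructor
          · rintro ⟨h1, h2⟩; exact ⟨h1, by simp [hFF x h1, h2]⟩
          · rintro ⟨h1, h2⟩; exact ⟨h1, by rw [← hFF x h1]; exact h2⟩
        rw [this]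
        exact isClosed_Icc.inter (isClosed_singleton.preimage hF')
      obtain ⟨E, hE, hne, hsub⟩ := exists_perfect_nonempty_of_isClosed_of_not_countable hcl hy
      haveI : Nonempty E := hne.to_subtype
      let d := TopologicalSpace.denseSeq E
      have hdS : ∀ n, (d n : ℝ) ∈ Sec F y := fun n => hsub (d n).2
      refine ⟨fun n => d n, ⟨fun n => (hdS n).1, fun n => ?_, fun n k => ?_⟩, ?_⟩
      · rw [hFF _ (hdS n).1, hFF _ (hdS 0).1, (hdS n).2, (hdS 0).2]
      · have hacc := accPt_iff_nhds.1 (hE.acc _ (d n).2) (Metric.ball (d n : ℝ) (1/((k:ℝ)+1)))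
          (Metric.ball_mem_nhds _ (by positivity))
        obtain ⟨z, ⟨hz1, hz2⟩, hz3⟩ := hacc
        have hopen : IsOpen {w : E | (w : ℝ) ≠ d n ∧ |(w : ℝ) - d n| < 1/((k:ℝ)+1)} :=
          (isOpen_ne_fun continuous_subtype_val continuous_const).inter
            (isOpen_lt (continuous_subtype_val.sub continuous_const).abs continuous_const)
        obtain ⟨m, hm⟩ := (TopologicalSpace.denseRange_denseSeq E).exists_mem_open hopen
          ⟨⟨z, hz2⟩, hz3, by simpa [Real.dist_eq] using hz1⟩
        exact ⟨m, hm⟩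
      · simp only
        rw [hFF _ (hdS 0).1, (hdS 0).2]
    · rintro ⟨x, ⟨h1, h2, h3⟩, rfl⟩
      have hpre : Preperfect (range x) := by
        rintro _ ⟨n, rfl⟩
        rw [accPt_iff_nhds]
        intro U hU
        obtain ⟨ε, he, hb⟩ := Metric.mem_nhds_iff.1 hU
        obtain ⟨k, hk⟩ := exists_nat_one_div_lt he
        obtain ⟨m, hm1, hm2⟩ := h3 n k
        exact ⟨x m, ⟨hb (by rw [Metric.mem_ball, Real.dist_eq]; exact hm2.trans hk), ⟨m, rfl⟩⟩, hm1⟩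
      obtain ⟨g, hg1, -, hg3⟩ := hpre.perfect_closure.exists_nat_bool_injection
        ⟨x 0, subset_closure ⟨0, rfl⟩⟩
      have hsub : closure (range x) ⊆ Sec F (F' (x 0)) := by
        have hcl2 : IsClosed (Icc (0:ℝ) 1 ∩ F' ⁻¹' {F' (x 0)}) :=
          isClosed_Icc.inter (isClosed_singleton.preimage hF')
        have := hcl2.closure_subset_iff.2 (show range x ⊆ _ by
          rintro _ ⟨n, rfl⟩; exact ⟨h1 n, h2 n⟩)
        intro t ht
        have h := this ht
        exact ⟨h.1, by rw [← hFF t h.1]; exact h.2⟩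
      intro hcount
      have h4 : (range g).Countable := hcount.mono (hg1.trans hsub)
      have h5 : (univ : Set (ℕ → Bool)).Countable := by
        refine Set.countable_of_injective_of_countable_image (f := g) hg3.injOn ?_
        rwa [image_univ]
      rw [← Cardinal.le_aleph0_iff_set_countable] at h5
      simp at h5
      exact absurd h5 (not_le.2 Cardinal.aleph0_lt_continuum)
  rw [himg]
  exact hD.analyticSet.image_of_continuous (hF'.comp (continuous_apply 0))
def dl (n : ℕ) : ℝ := (1/2:ℝ)^n

lemma dl_pos (n : ℕ) : 0 < dl n := by unfold dl; positivity

lemma dl_summable : Summable dl := summable_geometric_of_lt_one (by norm_num) (by norm_num)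

def Wt (X : Set ℕ) : ℝ := ∑' n, X.indicator dl n

lemma Wt_sum (X : Set ℕ) : Summable (X.indicator dl) := dl_summable.indicator X

lemma Wt_mono {X Y : Set ℕ} (h : X ⊆ Y) : Wt X ≤ Wt Y :=
  (Wt_sum X).tsum_le_tsum (fun n => indicator_le_indicator_of_subset h (fun n => (dl_pos n).le) n) (Wt_sum Y)

lemma Wt_union {X Y : Set ℕ} (h : Disjoint X Y) : Wt (X ∪ Y) = Wt X + Wt Y := by
  unfold Wt
  rw [← (Wt_sum X).tsum_add (Wt_sum Y)]
  congr 1; ext n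
  rw [indicator_union_of_disjoint h]

lemma Wt_empty : Wt ∅ = 0 := by simp [Wt]

lemma Wt_nonneg (X : Set ℕ) : 0 ≤ Wt X := by rw [← Wt_empty]; exact Wt_mono (empty_subset _)

lemma Wt_single (c : ℕ) : Wt {c} = dl c := by
  unfold Wt
  rw [tsum_eq_single c]
  · simp
  · intro b hb; simp [hb]

lemma Wt_fin (X : Set ℕ) (F : Finset ℕ) (h : (F : Set ℕ) ⊆ X) : ∑ n ∈ F, dl n ≤ Wt X := by
  have := (Wt_sum X).sum_le_tsum F (fun n _ => indicator_nonneg (fun n _ => (dl_pos n).le) n)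
  refine le_trans (le_of_eq (Finset.sum_congr rfl fun n hn => ?_)) this
  rw [indicator_of_mem (h hn)]

lemma Wt_le (X : Set ℕ) (K : ℝ) (h : ∀ F : Finset ℕ, (F : Set ℕ) ⊆ X → ∑ n ∈ F, dl n ≤ K) : Wt X ≤ K := by
  classical
  refine (Wt_sum X).tsum_le_of_sum_le (fun F => ?_)
  have := h (F.filter (· ∈ X)) (fun n hn => by simpa using (Finset.mem_filter.1 hn).2)
  rw [Finset.sum_filter] at this
  simpa [indicator_apply] using this

lemma staircase_nat (C : Set ℕ) (α : ℕ → ℝ) (A B : ℝ) (hAB : A < B)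
    (hC : ∀ c ∈ C, A ≤ α c ∧ α c < B) :
    ∃ (Φ : ℝ → ℝ) (r s : ℕ → ℝ), Continuous Φ ∧ (∀ t, A ≤ Φ t ∧ Φ t ≤ B) ∧ (∀ t ≤ 0, Φ t = A) ∧
      (∀ t, 1 ≤ t → Φ t = B) ∧
      (∀ c ∈ C, 0 ≤ r c ∧ r c < s c ∧ s c ≤ 1 ∧ ∀ t ∈ Icc (r c) (s c), Φ t = α c) ∧
      (∀ c ∈ C, ∀ c' ∈ C, ∀ t, t ∈ Ico (r c) (s c) → t ∈ Ico (r c') (s c') → c = c') ∧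
      (∀ y ∈ Ico A B, ∃! t, t ∈ Ico (0:ℝ) 1 ∧ Φ t = y ∧ ∀ c ∈ C, t ∉ Ico (r c) (s c)) ∧
      (∀ t < 1, Φ t < B) := by
  classical
  let Tm : ℝ → ℝ := fun y => (y - A) + Wt {n | n ∈ C ∧ α n < y}
  let Tp : ℝ → ℝ := fun y => (y - A) + Wt {n | n ∈ C ∧ α n ≤ y}
  let Z : ℝ := (B - A) + Wt C
  have hZ : 0 < Z := by have := Wt_nonneg C; simp only [Z]; linarith
  have hTp : ∀ y, Tp y = Tm y + Wt {n | n ∈ C ∧ α n = y} := by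
    intro y
    simp only [Tp, Tm]
    rw [add_assoc, ← Wt_union]
    · congr 2; ext n; simp only [mem_ofPred_eq, mem_union]; rw [le_iff_lt_or_eq]; tauto
    · rw [Set.disjoint_left]; rintro n ⟨_, h⟩ ⟨_, h'⟩; exact absurd h' h.ne
  have hTmlt : ∀ y y', y < y' → Tp y + (y' - y) ≤ Tm y' := by
    intro y y' h
    simp only [Tp, Tm]
    have : Wt {n | n ∈ C ∧ α n ≤ y} ≤ Wt {n | n ∈ C ∧ α n < y'} :=
      Wt_mono (fun n hn => ⟨hn.1, hn.2.trans_lt h⟩)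
    linarith
  have hTmmono : ∀ y y', y ≤ y' → Tm y + (y' - y) ≤ Tm y' := by
    intro y y' h
    simp only [Tm]
    have : Wt {n | n ∈ C ∧ α n < y} ≤ Wt {n | n ∈ C ∧ α n < y'} :=
      Wt_mono (fun n hn => ⟨hn.1, hn.2.trans_le h⟩)
    linarith
  have hTmA : Tm A = 0 := by
    simp only [Tm]
    have : {n | n ∈ C ∧ α n < A} = ∅ := by
      ext n; simp only [mem_ofPred_eq, mem_empty_iff_false, iff_false]
      rintro ⟨h, h'⟩; exact absurd (hC n h).1 (not_le.2 h')
    rw [this, Wt_empty]; ring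
  have hTmB : Tm B = Z := by
    simp only [Tm, Z]
    have : {n | n ∈ C ∧ α n < B} = C := by
      ext n; simp only [mem_ofPred_eq]; exact ⟨fun h => h.1, fun h => ⟨h, (hC n h).2⟩⟩
    rw [this]
  have hZT : ∀ y, Z - Tp y = (B - y) + Wt {n | n ∈ C ∧ y < α n} := by
    intro y
    have : C = {n | n ∈ C ∧ α n ≤ y} ∪ {n | n ∈ C ∧ y < α n} := by
      ext n; simp only [mem_ofPred_eq, mem_union]; have := le_or_gt (α n) y; tauto
    have h2 : Wt C = Wt {n | n ∈ C ∧ α n ≤ y} + Wt {n | n ∈ C ∧ y < α n} := by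
      rw [← Wt_union, ← this]
      rw [Set.disjoint_left]; rintro n ⟨_, h⟩ ⟨_, h'⟩; exact absurd h (not_le.2 h')
    simp only [Z, Tp]
    linarith
  have hZTm : ∀ y, Z - Tm y = (B - y) + Wt {n | n ∈ C ∧ y ≤ α n} := by
    intro y
    have : C = {n | n ∈ C ∧ α n < y} ∪ {n | n ∈ C ∧ y ≤ α n} := by
      ext n; simp only [mem_ofPred_eq, mem_union]; have := lt_or_ge (α n) y; tauto
    have h2 : Wt C = Wt {n | n ∈ C ∧ α n < y} + Wt {n | n ∈ C ∧ y ≤ α n} := by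
      rw [← Wt_union, ← this]
      rw [Set.disjoint_left]; rintro n ⟨_, h⟩ ⟨_, h'⟩; exact absurd h' (not_le.2 h)
    simp only [Z, Tm]
    linarith
  let Y : ℝ → Set ℝ := fun t => insert A {y | y ∈ Icc A B ∧ Tm y ≤ t}
  let Φ : ℝ → ℝ := fun t => sSup (Y t)
  have hYB : ∀ t, ∀ y ∈ Y t, y ≤ B := by
    rintro t y (rfl | h)
    · exact hAB.le
    · exact h.1.2
  have hYne : ∀ t, (Y t).Nonempty := fun t => ⟨A, mem_insert _ _⟩
  have hYb : ∀ t, BddAbove (Y t) := fun t => ⟨B, hYB t⟩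
  have hΦA : ∀ t, A ≤ Φ t := fun t => le_csSup (hYb t) (mem_insert _ _)
  have hΦB : ∀ t, Φ t ≤ B := fun t => csSup_le (hYne t) (hYB t)
  have F1 : ∀ t, ∀ y ∈ Icc A B, Tm y ≤ t → y ≤ Φ t := fun t y hy h =>
    le_csSup (hYb t) (mem_insert_of_mem _ ⟨hy, h⟩)
  have F3 : ∀ t t', t ≤ t' → Φ t ≤ Φ t' ∧ Φ t' ≤ Φ t + (t' - t) := by
    intro t t' h
    constructor
    · refine csSup_le_csSup (hYb _) (hYne _) (insert_subset_insert ?_)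
      intro y hy; exact ⟨hy.1, hy.2.trans h⟩
    · refine csSup_le (hYne _) ?_
      rintro y (rfl | hy)
      · have := hΦA t; linarith
      · by_cases hc : y - (t' - t) ≤ A
        · have := hΦA t; linarith
        · push Not at hc
          have := hTmmono (y - (t' - t)) y (by linarith)
          have := F1 t (y - (t' - t)) ⟨hc.le, by linarith [hy.1.2]⟩ (by linarith [hy.2])
          linarith
  have hcont : Continuous Φ := by
    have : LipschitzWith 1 Φ := by
      refine LipschitzWith.of_dist_le_mul fun t t' => ?_
      rw [Real.dist_eq, Real.dist_eq, NNReal.coe_one, one_mul]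
      rcases le_total t t' with h | h
      · have := F3 t t' h
        rw [abs_sub_comm, abs_sub_comm t, abs_of_nonneg (by linarith), abs_of_nonneg (by linarith)]
        linarith
      · have := F3 t' t h
        rw [abs_of_nonneg (by linarith), abs_of_nonneg (by linarith)]
        linarith
    exact this.continuous
  have F4 : ∀ t, ∀ y ∈ Icc A B, Tm y ≤ t → t ≤ Tp y → Φ t = y := by
    intro t y hy h h'
    refine le_antisymm (csSup_le (hYne _) ?_) (F1 t y hy h)
    rintro y' (rfl | h2)
    · exact hy.1
    · by_contra hcon
      push Not at hcon
      have := hTmlt y y' hcon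
      linarith [h2.2]
  have F5 : ∀ t, 0 ≤ t → Tm (Φ t) ≤ t := by
    intro t ht
    rcases eq_or_lt_of_le (hΦA t) with h | h
    · rw [← h, hTmA]; exact ht
    · have hall : ∀ y, y < Φ t → Tm y ≤ t := by
        intro y hy
        obtain ⟨y', hy', hlt⟩ := exists_lt_of_lt_csSup (hYne t) (show max y A < sSup (Y t) from max_lt hy h)
        rcases hy' with rfl | hy'
        · exact absurd (le_max_right _ _) (not_le.2 hlt)
        · have := hTmmono y y' ((le_max_left _ _).trans hlt.le)
          have h1 : y < y' := (le_max_left _ _).trans_lt hlt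
          linarith [hy'.2]
      have : Wt {n | n ∈ C ∧ α n < Φ t} ≤ t - (Φ t - A) := by
        refine Wt_le _ _ fun F hF => ?_
        have hy0 : ∃ y0 < Φ t, ∀ n ∈ F, α n < y0 := by
          have h3 : ∀ᶠ y in nhdsWithin (Φ t) (Iio (Φ t)), ∀ n ∈ F, α n < y := by
            rw [Finset.eventually_all]
            intro n hn
            exact nhdsWithin_le_nhds (Ioi_mem_nhds (hF hn).2)
          obtain ⟨y0, h4, h5⟩ := (h3.and self_mem_nhdsWithin).exists
          exact ⟨y0, h5, h4⟩
        obtain ⟨y0, hy0, hF0⟩ := hy0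
        refine le_of_forall_pos_le_add fun η hη => ?_
        let y' := max y0 (Φ t - η)
        have hy' : y' < Φ t := max_lt hy0 (by linarith)
        have h6 := hall y' hy'
        have h7 := Wt_fin {n | n ∈ C ∧ α n < y'} F
          (fun n hn => ⟨(hF hn).1, (hF0 n hn).trans_le (le_max_left _ _)⟩)
        have h8 : Φ t - η ≤ y' := le_max_right _ _
        simp only [Tm] at h6
        linarith
      simp only [Tm]; linarith
  have F6 : ∀ t, t ≤ Z → t ≤ Tp (Φ t) := by
    intro t ht
    rcases eq_or_lt_of_le (hΦB t) with h | h
    · rw [h, hTp, hTmB]; have := Wt_nonneg {n | n ∈ C ∧ α n = B}; linarith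
    · have hall : ∀ y, Φ t < y → y ≤ B → t ≤ Tm y := by
        intro y hy hyB
        by_contra hcon
        push Not at hcon
        exact absurd (F1 t y ⟨(hΦA t).trans hy.le, hyB⟩ hcon.le) (not_le.2 hy)
      have : Wt {n | n ∈ C ∧ Φ t < α n} ≤ (Z - t) - (B - Φ t) := by
        refine Wt_le _ _ fun F hF => ?_
        have hy0 : ∃ y0 > Φ t, ∀ n ∈ F, y0 < α n := by
          have h3 : ∀ᶠ y in nhdsWithin (Φ t) (Ioi (Φ t)), ∀ n ∈ F, y < α n := by
            rw [Finset.eventually_all]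
            intro n hn
            exact nhdsWithin_le_nhds (Iio_mem_nhds (hF hn).2)
          obtain ⟨y0, h4, h5⟩ := (h3.and self_mem_nhdsWithin).exists
          exact ⟨y0, h5, h4⟩
        obtain ⟨y0, hy0, hF0⟩ := hy0
        refine le_of_forall_pos_le_add fun η hη => ?_
        let y' := min (min y0 B) (Φ t + η)
        have hy' : Φ t < y' := lt_min (lt_min hy0 h) (by linarith)
        have hy'B : y' ≤ B := (min_le_left _ _).trans (min_le_right _ _)
        have h6 := hall y' hy' hy'B
        have h7 := Wt_fin {n | n ∈ C ∧ y' ≤ α n} F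
          (fun n hn => ⟨(hF hn).1, ((min_le_left _ _).trans (min_le_left _ _)).trans (hF0 n hn).le⟩)
        have h8 : y' ≤ Φ t + η := min_le_right _ _
        have h9 := hZTm y'
        linarith
      have := hZT (Φ t)
      linarith
  have F7 : ∀ t ≤ 0, Φ t = A := by
    intro t ht
    refine le_antisymm (csSup_le (hYne t) ?_) (hΦA t)
    rintro y (rfl | hy)
    · exact le_rfl
    · have := Wt_nonneg {n | n ∈ C ∧ α n < y}
      have h2 := hy.2
      simp only [Tm] at h2
      linarith
  have F8 : ∀ t, Z ≤ t → Φ t = B := fun t ht =>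
    le_antisymm (hΦB t) (F1 t B ⟨hAB.le, le_rfl⟩ (by rw [hTmB]; exact ht))
  have F9 : ∀ t < Z, Φ t < B := by
    intro t ht
    refine lt_of_le_of_ne (hΦB t) fun h => ?_
    rcases le_total t 0 with h0 | h0
    · rw [F7 t h0] at h; exact absurd h hAB.ne
    · have := F5 t h0
      rw [h, hTmB] at this
      linarith
  let u : ℕ → ℝ := fun c => Tm (α c) + Wt {n | n ∈ C ∧ α n = α c ∧ n < c}
  let v : ℕ → ℝ := fun c => u c + dl c
  have hv : ∀ c ∈ C, v c = Tm (α c) + Wt {n | n ∈ C ∧ α n = α c ∧ n < c + 1} := by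
    intro c hc
    simp only [v, u]
    rw [← Wt_single c, add_assoc, ← Wt_union]
    · congr 2; ext n; simp only [mem_ofPred_eq, mem_union, mem_singleton_iff, Nat.lt_succ_iff_lt_or_eq]
      constructor
      · rintro (h | rfl)
        · tauto
        · tauto
      · tauto
    · rw [Set.disjoint_left]; rintro n ⟨_, h, h2⟩ h'; exact absurd h' h2.ne
  have huv : ∀ c ∈ C, Tm (α c) ≤ u c ∧ v c ≤ Tp (α c) := by
    intro c hc
    constructor
    · have := Wt_nonneg {n | n ∈ C ∧ α n = α c ∧ n < c}; simp only [u]; linarith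
    · rw [hv c hc, hTp]
      have : Wt {n | n ∈ C ∧ α n = α c ∧ n < c + 1} ≤ Wt {n | n ∈ C ∧ α n = α c} :=
        Wt_mono fun n hn => ⟨hn.1, hn.2.1⟩
      linarith
  have hval : ∀ c ∈ C, ∀ t ∈ Icc (u c) (v c), Φ t = α c := fun c hc t ht =>
    F4 t (α c) ⟨(hC c hc).1, (hC c hc).2.le⟩ ((huv c hc).1.trans ht.1) (ht.2.trans (huv c hc).2)
  have hTm0 : ∀ y, A ≤ y → 0 ≤ Tm y := fun y hy => by
    have := hTmmono A y hy; rw [hTmA] at this; linarith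
  have hTpZ : ∀ y < B, Tp y < Z := fun y hy => by
    have := hTmlt y B hy; rw [hTmB] at this; linarith
  refine ⟨fun t => Φ (t * Z), fun c => u c / Z, fun c => v c / Z, hcont.comp (continuous_mul_const Z),
    fun t => ⟨hΦA _, hΦB _⟩, ?_, ?_, ?_, ?_, ?_, ?_⟩
  · intro t ht; exact F7 _ (mul_nonpos_of_nonpos_of_nonneg ht hZ.le)
  · intro t ht; exact F8 _ (by nlinarith)
  · intro c hc
    refine ⟨div_nonneg ((hTm0 _ (hC c hc).1).trans (huv c hc).1) hZ.le, ?_, ?_, ?_⟩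
    · exact div_lt_div_of_pos_right (by simp only [v]; linarith [dl_pos c]) hZ
    · rw [div_le_one hZ]; exact (huv c hc).2.trans (hTpZ _ (hC c hc).2).le
    · intro t ht
      exact hval c hc _ ⟨(div_le_iff₀ hZ).1 ht.1, (le_div_iff₀ hZ).1 ht.2⟩
  · have key : ∀ c ∈ C, ∀ c' ∈ C, c < c' → α c = α c' → v c ≤ u c' := by
      intro c hc c' hc' hlt he
      rw [hv c hc]
      simp only [u]
      rw [he]
      have : Wt {n | n ∈ C ∧ α n = α c' ∧ n < c + 1} ≤ Wt {n | n ∈ C ∧ α n = α c' ∧ n < c'} :=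
        Wt_mono fun n hn => ⟨hn.1, hn.2.1, by have := hn.2.2; omega⟩
      linarith
    intro c hc c' hc' t ht ht'
    have h1 : t * Z ∈ Ico (u c) (v c) := ⟨(div_le_iff₀ hZ).1 ht.1, (lt_div_iff₀ hZ).1 ht.2⟩
    have h2 : t * Z ∈ Ico (u c') (v c') := ⟨(div_le_iff₀ hZ).1 ht'.1, (lt_div_iff₀ hZ).1 ht'.2⟩
    have he : α c = α c' := by
      rw [← hval c hc _ (Ico_subset_Icc_self h1), hval c' hc' _ (Ico_subset_Icc_self h2)]
    rcases lt_trichotomy c c' with h | h | h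
    · have := key c hc c' hc' h he; linarith [h1.2, h2.1]
    · exact h
    · have := key c' hc' c hc h he.symm; linarith [h2.2, h1.1]
  · intro y hy
    have hyI : y ∈ Icc A B := Ico_subset_Icc_self hy
    have hmp : Tm y ≤ Tp y := by rw [hTp]; linarith [Wt_nonneg {n | n ∈ C ∧ α n = y}]
    have hcanc : Tp y / Z * Z = Tp y := div_mul_cancel₀ _ hZ.ne'
    refine ⟨Tp y / Z, ⟨⟨div_nonneg ((hTm0 y hy.1).trans hmp) hZ.le, (div_lt_one hZ).2 (hTpZ y hy.2)⟩, ?_, ?_⟩, ?_⟩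
    · simp only [hcanc]; exact F4 _ y hyI hmp le_rfl
    · intro c hc ht
      have h1 : Tp y ∈ Ico (u c) (v c) := by
        rw [← hcanc]; exact ⟨(div_le_iff₀ hZ).1 ht.1, (lt_div_iff₀ hZ).1 ht.2⟩
      have he : α c = y := by
        rw [← hval c hc _ (Ico_subset_Icc_self h1)]; exact F4 _ y hyI hmp le_rfl
      have := (huv c hc).2
      rw [he] at this
      linarith [h1.2]
    · rintro t ⟨⟨ht0, ht1⟩, hty, htC⟩
      simp only at hty
      have ht0' : 0 ≤ t * Z := by positivity
      have ht1' : t * Z ≤ Z := by nlinarith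
      have h5 := F5 _ ht0'
      have h6 := F6 _ ht1'
      rw [hty] at h5 h6
      rw [eq_div_iff hZ.ne']
      by_contra hne
      have hlt : t * Z < Tp y := lt_of_le_of_ne h6 hne
      have hex : ∃ n, t * Z < Tm y + Wt {k | k ∈ C ∧ α k = y ∧ k < n} := by
        by_contra hcon
        push Not at hcon
        have : Wt {n | n ∈ C ∧ α n = y} ≤ t * Z - Tm y := by
          refine Wt_le _ _ fun F hF => ?_
          obtain ⟨N, hN⟩ := F.exists_nat_subset_range
          have := Wt_fin {k | k ∈ C ∧ α k = y ∧ k < N} F (fun n hn => ⟨(hF hn).1, (hF hn).2, by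
            simpa using hN hn⟩)
          linarith [hcon N]
        rw [hTp] at hlt
        linarith
      have hspec := Nat.find_spec hex
      have hmin := fun m => Nat.find_min hex (m := m)
      rcases hn : Nat.find hex with _ | m
      · rw [hn] at hspec
        have : {k | k ∈ C ∧ α k = y ∧ k < 0} = ∅ := by ext; simp
        rw [this, Wt_empty] at hspec
        linarith
      · have h7 := hmin m (by omega)
        rw [hn] at hspec
        push Not at h7
        by_cases hm : m ∈ C ∧ α m = y
        · apply htC m hm.1
          have h8 := hv m hm.1
          rw [hm.2] at h8
          refine ⟨(div_le_iff₀ hZ).2 ?_, (lt_div_iff₀ hZ).2 ?_⟩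
          · simp only [u]; rw [hm.2]; exact h7
          · rw [h8]; exact hspec
        · have : {k | k ∈ C ∧ α k = y ∧ k < m + 1} = {k | k ∈ C ∧ α k = y ∧ k < m} := by
            ext k; simp only [mem_ofPred_eq]
            constructor
            · rintro ⟨a, b, c⟩
              refine ⟨a, b, lt_of_le_of_ne (Nat.lt_succ_iff.1 c) ?_⟩
              rintro rfl; exact hm ⟨a, b⟩
            · rintro ⟨a, b, c⟩; exact ⟨a, b, by omega⟩
          rw [this] at hspec
          linarith
  · intro t ht; exact F9 _ (by nlinarith)

lemma staircase {ι : Type} [Countable ι] (C : Set ι) (α : ι → ℝ) (A B : ℝ) (hAB : A ≤ B)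
    (hC : ∀ c ∈ C, A ≤ α c ∧ α c < B) :
    ∃ (Φ : ℝ → ℝ) (r s : ι → ℝ), Continuous Φ ∧ (∀ t, A ≤ Φ t ∧ Φ t ≤ B) ∧ (∀ t ≤ 0, Φ t = A) ∧
      (∀ t, 1 ≤ t → Φ t = B) ∧
      (∀ c ∈ C, 0 ≤ r c ∧ r c < s c ∧ s c ≤ 1 ∧ ∀ t ∈ Icc (r c) (s c), Φ t = α c) ∧
      (∀ c ∈ C, ∀ c' ∈ C, ∀ t, t ∈ Ico (r c) (s c) → t ∈ Ico (r c') (s c') → c = c') ∧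
      (∀ y ∈ Ico A B, ∃! t, t ∈ Ico (0:ℝ) 1 ∧ Φ t = y ∧ ∀ c ∈ C, t ∉ Ico (r c) (s c)) ∧
      (A < B → ∀ t < 1, Φ t < B) := by
  rcases eq_or_lt_of_le hAB with h | h
  · subst h
    have : ∀ c, c ∉ C := fun c hc => absurd (hC c hc).1 (not_le.2 (hC c hc).2)
    exact ⟨fun _ => A, fun _ => 0, fun _ => 0, continuous_const, fun _ => ⟨le_rfl, le_rfl⟩, fun _ _ => rfl,
      fun _ _ => rfl, fun c hc => absurd hc (this c), fun c hc => absurd hc (this c),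
      fun y hy => absurd hy.1 (not_le.2 hy.2), fun h => absurd h (lt_irrefl _)⟩
  · obtain ⟨e, he⟩ := exists_injective_nat ι
    have hext : ∀ c, Function.extend e α 0 (e c) = α c := fun c => he.extend_apply _ _ _
    obtain ⟨Φ, r, s, h1, h2, h3, h4, h5, h6, h7, h8⟩ := staircase_nat (e '' C) (Function.extend e α 0) A B h
      (by rintro _ ⟨c, hc, rfl⟩; rw [hext]; exact hC c hc)
    refine ⟨Φ, fun c => r (e c), fun c => s (e c), h1, h2, h3, h4, ?_, ?_, ?_, fun _ => h8⟩
    · intro c hc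
      have := h5 (e c) ⟨c, hc, rfl⟩
      rwa [hext] at this
    · intro c hc c' hc' t ht ht'
      exact he (h6 _ ⟨c, hc, rfl⟩ _ ⟨c', hc', rfl⟩ t ht ht')
    · intro y hy
      have := h7 y hy
      simpa only [forall_mem_image] using this

structure TD (ι : Type) where
  root : ι
  a : ι → ℝ
  b : ι → ℝ
  par : ι → ι
  d : ι → ℕ
  P : ι → ℝ → ℝ
  r : ι → ℝ
  s : ι → ℝ
  ha : a root = 0
  hb : b root = 1
  hd0 : ∀ i, d i = 0 ↔ i = root
  hds : ∀ i, i ≠ root → d i = d (par i) + 1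
  hpa : ∀ i, i ≠ root → a (par i) ≤ a i
  hpb : ∀ i, i ≠ root → b i ≤ b (par i)
  hab : ∀ i, a i ≤ b i
  hlen : ∀ i, b i - a i ≤ 2 * (1/2:ℝ)^(d i)
  hfin : ∀ ε > 0, {i | ε ≤ b i - a i}.Finite
  hPc : ∀ i, Continuous (P i)
  hPm : ∀ i t, a i ≤ P i t ∧ P i t ≤ b i
  hP0 : ∀ i, ∀ t ≤ 0, P i t = a i
  hP1 : ∀ i t, 1 ≤ t → P i t = b i
  hrs : ∀ i, i ≠ root → 0 ≤ r i ∧ r i < s i ∧ s i ≤ 1 ∧ ∀ t ∈ Icc (r i) (s i), P (par i) t = a i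
  hdis : ∀ i j, i ≠ root → j ≠ root → par i = par j → ∀ t, t ∈ Ico (r i) (s i) → t ∈ Ico (r j) (s j) → i = j
  huni : ∀ i, ∀ y ∈ Ico (a i) (b i), ∃! t, t ∈ Ico (0:ℝ) 1 ∧ P i t = y ∧
    ∀ c, c ≠ root → par c = i → t ∉ Ico (r c) (s c)
  hlt : ∀ i, a i < b i → ∀ t < 1, P i t < b i

namespace TD

variable {ι : Type} (T : TD ι)

def Rn : ℕ → ι → ℝ → ℝ
  | 0, _, x => x
  | n+1, i, x => (Rn n (T.par i) x - T.r i) * (2 / (T.s i - T.r i))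

def R (i : ι) (x : ℝ) : ℝ := T.Rn (T.d i) i x

lemma d_root : T.d T.root = 0 := (T.hd0 _).2 rfl

lemma R_root (x : ℝ) : T.R T.root x = x := by simp [R, d_root, Rn]

lemma R_succ (i : ι) (hi : i ≠ T.root) (x : ℝ) :
    T.R i x = (T.R (T.par i) x - T.r i) * (2 / (T.s i - T.r i)) := by
  simp [R, T.hds i hi, Rn]

lemma ind (Q : ι → Prop) (h0 : Q T.root) (hs : ∀ i, i ≠ T.root → Q (T.par i) → Q i) (i : ι) : Q i := by
  have : ∀ n i, T.d i = n → Q i := by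
    intro n
    induction n with
    | zero => intro i hi; rw [(T.hd0 i).1 hi]; exact h0
    | succ n ih =>
      intro i hi
      have hr : i ≠ T.root := by intro h; rw [(T.hd0 i).2 h] at hi; omega
      exact hs i hr (ih _ (by have := T.hds i hr; omega))
  exact this _ i rfl

lemma R_aff (i : ι) : ∃ p q : ℝ, 0 < p ∧ ∀ x, T.R i x = p * x + q := by
  refine T.ind (fun i => ∃ p q : ℝ, 0 < p ∧ ∀ x, T.R i x = p * x + q) ⟨1, 0, one_pos, fun x => ?_⟩ ?_ i
  · rw [R_root]; ring
  · rintro i hi ⟨p, q, hp, h⟩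
    have := (T.hrs i hi).2.1
    refine ⟨p * (2 / (T.s i - T.r i)), (q - T.r i) * (2 / (T.s i - T.r i)), ?_, fun x => ?_⟩
    · have : 0 < T.s i - T.r i := by linarith
      positivity
    · rw [R_succ T i hi, h]; ring

lemma R_cont (i : ι) : Continuous (T.R i) := by
  obtain ⟨p, q, _, h⟩ := T.R_aff i
  rw [show T.R i = fun x => p * x + q from funext h]; fun_prop

lemma R_inj (i : ι) : Function.Injective (T.R i) := by
  obtain ⟨p, q, hp, h⟩ := T.R_aff i
  intro x y hxy
  rw [h, h] at hxy
  have : p * x = p * y := by linarith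
  exact mul_left_cancel₀ hp.ne' this

lemma R_surj (i : ι) (t : ℝ) : ∃ x, T.R i x = t := by
  obtain ⟨p, q, hp, h⟩ := T.R_aff i
  exact ⟨(t - q) / p, by rw [h]; field_simp; ring⟩

lemma R_cpt (i : ι) : IsCompact {x | T.R i x ∈ Icc (0:ℝ) 2} := by
  obtain ⟨p, q, hp, h⟩ := T.R_aff i
  have : {x | T.R i x ∈ Icc (0:ℝ) 2} = Icc ((0 - q) / p) ((2 - q) / p) := by
    ext x
    simp only [mem_ofPred_eq, mem_Icc, h]
    rw [div_le_iff₀ hp, le_div_iff₀ hp]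
    constructor <;> rintro ⟨h1, h2⟩ <;> constructor <;> linarith
  rw [this]; exact isCompact_Icc

def J (i : ι) (x : ℝ) : Prop := 0 ≤ T.R i x ∧ T.R i x < 2

lemma R_mem_iff (i : ι) (hi : i ≠ T.root) (x : ℝ) :
    T.R i x ∈ Icc (0:ℝ) 2 ↔ T.R (T.par i) x ∈ Icc (T.r i) (T.s i) := by
  have h := (T.hrs i hi).2.1
  have h' : 0 < T.s i - T.r i := by linarith
  rw [R_succ T i hi, mul_div_assoc', mem_Icc, mem_Icc, le_div_iff₀ h', div_le_iff₀ h']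
  constructor <;> rintro ⟨h1, h2⟩ <;> constructor <;> linarith

lemma J_iff (i : ι) (hi : i ≠ T.root) (x : ℝ) :
    T.J i x ↔ T.R (T.par i) x ∈ Ico (T.r i) (T.s i) := by
  have h := (T.hrs i hi).2.1
  have h' : 0 < T.s i - T.r i := by linarith
  rw [J, R_succ T i hi, mul_div_assoc', mem_Ico, le_div_iff₀ h', div_lt_iff₀ h']
  constructor <;> rintro ⟨h1, h2⟩ <;> constructor <;> linarith

lemma J_par (i : ι) (hi : i ≠ T.root) (x : ℝ) (h : T.J i x) :
    T.J (T.par i) x ∧ T.R (T.par i) x < 1 := by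
  have h1 := (T.J_iff i hi x).1 h
  have h2 := T.hrs i hi
  refine ⟨⟨?_, ?_⟩, ?_⟩ <;> linarith [h1.1, h1.2, h2.1, h2.2.1, h2.2.2.1]

lemma J_dis : ∀ i j x, T.d i = T.d j → T.J i x → T.J j x → i = j := by
  have : ∀ n i j x, T.d i = n → T.d j = n → T.J i x → T.J j x → i = j := by
    intro n
    induction n with
    | zero => intro i j x hi hj _ _; rw [(T.hd0 i).1 hi, (T.hd0 j).1 hj]
    | succ n ih =>
      intro i j x hi hj h1 h2
      have hri : i ≠ T.root := by intro h; rw [(T.hd0 i).2 h] at hi; omega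
      have hrj : j ≠ T.root := by intro h; rw [(T.hd0 j).2 h] at hj; omega
      have hp := ih (T.par i) (T.par j) x (by have := T.hds i hri; omega)
        (by have := T.hds j hrj; omega) (T.J_par i hri x h1).1 (T.J_par j hrj x h2).1
      refine T.hdis i j hri hrj hp _ ((T.J_iff i hri x).1 h1) ?_
      rw [hp]; exact (T.J_iff j hrj x).1 h2
  exact fun i j x h => this _ i j x rfl h.symm

lemma J_unit (i : ι) : i ≠ T.root → ∀ x, T.J i x → x ∈ Ico (0:ℝ) 1 := by
  refine T.ind (fun i => i ≠ T.root → ∀ x, T.J i x → x ∈ Ico (0:ℝ) 1) (fun h => absurd rfl h) ?_ i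
  intro i hi ih _ x hx
  obtain ⟨h1, h2⟩ := T.J_par i hi x hx
  by_cases h : T.par i = T.root
  · rw [h] at h1 h2
    have := h1.1
    rw [R_root] at this h2
    exact ⟨this, h2⟩
  · exact ih h x h1

lemma child_of_deeper (i j : ι) (x : ℝ) (hi : T.J i x) : T.J j x → T.d i < T.d j →
    ∃ c, c ≠ T.root ∧ T.par c = i ∧ T.J c x := by
  refine T.ind (fun j => T.J j x → T.d i < T.d j → ∃ c, c ≠ T.root ∧ T.par c = i ∧ T.J c x)
    ?_ ?_ j
  · intro _ h; rw [d_root] at h; omega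
  · intro j hj ih hJ hlt
    have hd := T.hds j hj
    have hp := (T.J_par j hj x hJ).1
    rcases lt_or_ge (T.d i) (T.d (T.par j)) with h | h
    · exact ih hp h
    · exact ⟨j, hj, T.J_dis _ _ x (by omega) hp hi, hJ⟩

def tent (i : ι) (t : ℝ) : ℝ := min (T.P i t - T.a i) (max 0 ((2 - t) * (T.b i - T.a i)))

def h (i : ι) (x : ℝ) : ℝ := T.tent i (T.R i x)

lemma h_cont (i : ι) : Continuous (T.h i) := by
  have h1 := T.hPc i
  have h2 := T.R_cont i
  unfold h tent
  fun_prop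

lemma h_nonneg (i : ι) (x : ℝ) : 0 ≤ T.h i x :=
  le_min (by linarith [(T.hPm i (T.R i x)).1]) (le_max_left _ _)

lemma h_le (i : ι) (x : ℝ) : T.h i x ≤ T.b i - T.a i :=
  (min_le_left _ _).trans (by linarith [(T.hPm i (T.R i x)).2])

lemma h_zero (i : ι) (x : ℝ) (hx : ¬ T.J i x) : T.h i x = 0 := by
  apply le_antisymm _ (T.h_nonneg i x)
  have hl : 0 ≤ T.b i - T.a i := by linarith [T.hab i]
  rcases lt_or_ge (T.R i x) 0 with h0 | h0
  · exact (min_le_left _ _).trans (by rw [T.hP0 i _ h0.le]; simp)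
  · have h2 : 2 ≤ T.R i x := by by_contra hc; exact hx ⟨h0, not_le.1 hc⟩
    refine (min_le_right _ _).trans (max_le le_rfl ?_)
    nlinarith

lemma h_up (i : ι) (x : ℝ) (hx : T.R i x ≤ 1) : T.h i x = T.P i (T.R i x) - T.a i := by
  have hl : 0 ≤ T.b i - T.a i := by linarith [T.hab i]
  refine min_eq_left (le_max_of_le_right ?_)
  have := (T.hPm i (T.R i x)).2
  nlinarith

lemma h_down (i : ι) (x : ℝ) (hx : 1 ≤ T.R i x) (hx2 : T.R i x ≤ 2) :
    T.h i x = (2 - T.R i x) * (T.b i - T.a i) := by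
  have hl : 0 ≤ T.b i - T.a i := by linarith [T.hab i]
  have h0 : 0 ≤ (2 - T.R i x) * (T.b i - T.a i) := mul_nonneg (by linarith) hl
  rw [h, tent, T.hP1 i _ hx, max_eq_right h0]
  exact min_eq_right (by nlinarith)

open Classical in
def H (n : ℕ) (x : ℝ) : ℝ := ∑' i, if T.d i = n then T.h i x else 0

lemma H_eq (i : ι) (x : ℝ) (hx : T.J i x) : T.H (T.d i) x = T.h i x := by
  classical
  rw [H, tsum_eq_single i]
  · simp
  · intro j hj
    split_ifs with hd
    · exact T.h_zero j x (fun hJ => hj (T.J_dis _ _ x hd hJ hx))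
    · rfl

lemma H_zero (n : ℕ) (x : ℝ) (hx : ∀ i, T.d i = n → ¬ T.J i x) : T.H n x = 0 := by
  classical
  rw [H]
  convert tsum_zero with i
  split_ifs with hd
  · exact T.h_zero i x (hx i hd)
  · rfl

lemma H_bd (n : ℕ) (x : ℝ) : ‖T.H n x‖ ≤ 2 * (1/2:ℝ)^n := by
  by_cases hx : ∃ i, T.d i = n ∧ T.J i x
  · obtain ⟨i, rfl, hJ⟩ := hx
    rw [T.H_eq i x hJ, Real.norm_of_nonneg (T.h_nonneg i x)]
    exact (T.h_le i x).trans (T.hlen i)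
  · push Not at hx
    rw [T.H_zero n x hx]; simp

lemma H_cont (n : ℕ) : Continuous (T.H n) := by
  classical
  apply continuous_of_uniform_approx_of_continuous
  intro u hu
  obtain ⟨ε, hε, hεu⟩ := Metric.mem_uniformity_dist.1 hu
  refine ⟨fun x => ∑ i ∈ (T.hfin ε hε).toFinset, if T.d i = n then T.h i x else 0, ?_, ?_⟩
  · refine continuous_finsetSum _ (fun i _ => ?_)
    split_ifs
    · exact T.h_cont i
    · exact continuous_const
  · intro x
    apply hεu
    beta_reduce
    by_cases hx : ∃ i, T.d i = n ∧ T.J i x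
    · obtain ⟨i, rfl, hJ⟩ := hx
      rw [T.H_eq i x hJ]
      have hz : ∀ j, j ≠ i → (if T.d j = T.d i then T.h j x else 0) = 0 := by
        intro j hj
        split_ifs with hd
        · exact T.h_zero j x (fun hJ' => hj (T.J_dis _ _ x hd hJ' hJ))
        · rfl
      by_cases hi : i ∈ (T.hfin ε hε).toFinset
      · rw [Finset.sum_eq_single_of_mem i hi (fun j _ hj => hz j hj)]
        simpa using hε
      · rw [Finset.sum_eq_zero (fun j hj => hz j (fun e => hi (e ▸ hj)))]
        have : T.b i - T.a i < ε := by simpa using hi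
        rw [Real.dist_eq, sub_zero, abs_of_nonneg (T.h_nonneg i x)]
        exact (T.h_le i x).trans_lt this
    · push Not at hx
      rw [T.H_zero n x hx, Finset.sum_eq_zero]
      · simpa using hε
      · intro j _
        split_ifs with hd
        · exact T.h_zero j x (hx j hd)
        · rfl

def F (x : ℝ) : ℝ := ∑' n, T.H n x

lemma sum_bd : Summable (fun n : ℕ => 2 * (1/2:ℝ)^n) :=
  (summable_geometric_of_lt_one (by norm_num) (by norm_num)).mul_left 2

lemma F_cont : Continuous T.F := continuous_tsum T.H_cont sum_bd T.H_bd

def S (n : ℕ) (x : ℝ) : ℝ := ∑ k ∈ Finset.range n, T.H k x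

lemma S_tendsto (x : ℝ) : Filter.Tendsto (fun n => T.S n x) Filter.atTop (nhds (T.F x)) :=
  (Summable.of_norm_bounded sum_bd (fun n => T.H_bd n x)).hasSum.tendsto_sum_nat

lemma S_eq (i : ι) (x : ℝ) : T.J i x → T.S (T.d i) x = T.a i := by
  refine T.ind (fun i => T.J i x → T.S (T.d i) x = T.a i) ?_ ?_ i
  · intro _; rw [d_root, T.ha]; simp [S]
  · intro i hi ih hJ
    obtain ⟨hp, hlt⟩ := T.J_par i hi x hJ
    rw [T.hds i hi, S, Finset.sum_range_succ]
    have := ih hp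
    rw [S] at this
    rw [this, T.H_eq _ x hp, T.h_up _ x hlt.le,
      (T.hrs i hi).2.2.2 _ (Ico_subset_Icc_self ((T.J_iff i hi x).1 hJ))]
    ring

lemma S_succ (i : ι) (x : ℝ) (hJ : T.J i x) : T.S (T.d i + 1) x = T.a i + T.h i x := by
  have := T.S_eq i x hJ
  rw [S] at this ⊢
  rw [Finset.sum_range_succ, this, T.H_eq i x hJ]

def term (i : ι) (x : ℝ) : Prop := T.J i x ∧ ∀ c, c ≠ T.root → T.par c = i → ¬ T.J c x

lemma S_term (i : ι) (x : ℝ) (ht : T.term i x) (k : ℕ) :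
    T.S (T.d i + 1 + k) x = T.a i + T.h i x := by
  induction k with
  | zero => exact T.S_succ i x ht.1
  | succ k ih =>
    rw [← add_assoc, S, Finset.sum_range_succ]
    rw [S] at ih
    rw [ih, T.H_zero, add_zero]
    intro j hj hJ
    obtain ⟨c, h1, h2, h3⟩ := T.child_of_deeper i j x ht.1 hJ (by omega)
    exact ht.2 c h1 h2 h3

lemma S_mem (k : ℕ) : ∀ (i : ι) (x : ℝ), T.J i x → T.S (T.d i + 1 + k) x ∈ Icc (T.a i) (T.b i) := by
  have hh : ∀ (i : ι) (x : ℝ), T.a i + T.h i x ∈ Icc (T.a i) (T.b i) := fun i x =>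
    ⟨by linarith [T.h_nonneg i x], by linarith [T.h_le i x]⟩
  induction k with
  | zero => intro i x hJ; rw [add_zero, T.S_succ i x hJ]; exact hh i x
  | succ k ih =>
    intro i x hJ
    by_cases ht : ∃ c, c ≠ T.root ∧ T.par c = i ∧ T.J c x
    · obtain ⟨c, h1, rfl, h3⟩ := ht
      have := ih c x h3
      rw [T.hds c h1, show T.d (T.par c) + 1 + 1 + k = T.d (T.par c) + 1 + (k + 1) by ring] at this
      exact ⟨(T.hpa c h1).trans this.1, this.2.trans (T.hpb c h1)⟩
    · push Not at ht
      rw [T.S_term i x ⟨hJ, ht⟩]; exact hh i x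

lemma F_mem (i : ι) (x : ℝ) (hJ : T.J i x) : T.F x ∈ Icc (T.a i) (T.b i) := by
  refine isClosed_Icc.mem_of_tendsto (T.S_tendsto x) ?_
  filter_upwards [Filter.eventually_ge_atTop (T.d i + 1)] with n hn
  obtain ⟨k, rfl⟩ := Nat.exists_eq_add_of_le hn
  exact T.S_mem k i x hJ

lemma F_term (i : ι) (x : ℝ) (ht : T.term i x) : T.F x = T.a i + T.h i x := by
  refine tendsto_nhds_unique (T.S_tendsto x) (tendsto_const_nhds.congr' ?_)
  filter_upwards [Filter.eventually_ge_atTop (T.d i + 1)] with n hn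
  obtain ⟨k, rfl⟩ := Nat.exists_eq_add_of_le hn
  exact (T.S_term i x ht k).symm

def Branch (y : ℝ) : Set (ℕ → ι) :=
  {β | ∀ n, T.d (β n) = n ∧ T.par (β (n+1)) = β n ∧ y ∈ Icc (T.a (β n)) (T.b (β n))}

lemma exists_term (x : ℝ) (hx : x ∈ Icc (0:ℝ) 1) (hb : ∀ β, β ∉ T.Branch (T.F x)) : ∃ i, T.term i x := by
  by_contra hc
  push Not at hc
  have hc' : ∀ i, T.J i x → ∃ c, c ≠ T.root ∧ T.par c = i ∧ T.J c x := by
    intro i hi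
    by_contra h
    push Not at h
    exact hc i ⟨hi, h⟩
  choose g hg1 hg2 hg3 using hc'
  have hroot : T.J T.root x := by rw [J, R_root]; exact ⟨hx.1, by linarith [hx.2]⟩
  let β : ℕ → {i // T.J i x} := fun n => Nat.rec ⟨T.root, hroot⟩ (fun _ p => ⟨g p.1 p.2, hg3 p.1 p.2⟩) n
  have hpar : ∀ n, T.par (β (n+1)).1 = (β n).1 := fun n => hg2 _ (β n).2
  have hd : ∀ n, T.d (β n).1 = n := by
    intro n
    induction n with
    | zero => exact T.d_root
    | succ n ih => rw [T.hds _ (hg1 _ (β n).2), hpar n, ih]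
  exact hb (fun n => (β n).1) (fun n => ⟨hd n, hpar n, T.F_mem _ x (β n).2⟩)

lemma term_unique (i j : ι) (x : ℝ) (hi : T.term i x) (hj : T.term j x) : i = j := by
  rcases lt_trichotomy (T.d i) (T.d j) with h | h | h
  · obtain ⟨c, h1, h2, h3⟩ := T.child_of_deeper i j x hi.1 hj.1 h
    exact absurd h3 (hi.2 c h1 h2)
  · exact T.J_dis i j x h hi.1 hj.1
  · obtain ⟨c, h1, h2, h3⟩ := T.child_of_deeper j i x hj.1 hi.1 h
    exact absurd h3 (hj.2 c h1 h2)

lemma term_of_ge (i : ι) (x : ℝ) (h1 : 1 ≤ T.R i x) (h2 : T.R i x < 2) : T.term i x := by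
  refine ⟨⟨by linarith, h2⟩, ?_⟩
  rintro c hc rfl hJ
  linarith [(T.J_par c hc x hJ).2]

lemma F_maps : MapsTo T.F (Icc 0 1) (Icc 0 1) := by
  intro x hx
  have := T.F_mem T.root x (by rw [J, R_root]; exact ⟨hx.1, by linarith [hx.2]⟩)
  rwa [T.ha, T.hb] at this

lemma F_one : T.F 1 = 1 := by
  rw [T.F_term T.root 1 (T.term_of_ge _ _ (by rw [R_root]) (by rw [R_root]; norm_num)),
    T.h_down _ _ (by rw [R_root]) (by rw [R_root]; norm_num), R_root, T.ha, T.hb]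
  norm_num

/-- flats -/
lemma flat_card (y : ℝ) (i : ι) (h1 : T.a i = y) (h2 : T.b i = y) : 𝔠 ≤ #(Sec T.F y) := by
  have hi : i ≠ T.root := by
    rintro rfl
    rw [T.ha] at h1; rw [T.hb] at h2; linarith
  choose g hg using T.R_surj i
  have hm : ∀ t ∈ Ico (0:ℝ) 2, g t ∈ Sec T.F y := by
    intro t ht
    have hJ : T.J i (g t) := by rw [J, hg]; exact ht
    have := T.J_unit i hi _ hJ
    have h3 := T.F_mem i _ hJ
    rw [h1, h2] at h3
    exact ⟨Ico_subset_Icc_self this, le_antisymm h3.2 h3.1⟩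
  rw [← Cardinal.mk_Ico_real (show (0:ℝ) < 2 by norm_num)]
  refine Cardinal.mk_le_of_injective (f := fun t : Ico (0:ℝ) 2 => (⟨g t, hm t t.2⟩ : Sec T.F y)) ?_
  intro t t' h
  have : g t = g t' := congrArg Subtype.val h
  apply Subtype.ext
  rw [← hg t, ← hg t', this]

lemma ne_root_of_branch {y : ℝ} {β : ℕ → ι} (hβ : β ∈ T.Branch y) (n : ℕ) : β (n+1) ≠ T.root := by
  intro h
  have := (hβ (n+1)).1
  rw [(T.hd0 _).2 h] at this; omega

lemma branch_pt (y : ℝ) (β : ℕ → ι) (hβ : β ∈ T.Branch y) : ∃ x ∈ Sec T.F y, ∀ n, T.J (β n) x := by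
  have hne := T.ne_root_of_branch hβ
  have hstep : ∀ n x, T.R (β (n+1)) x ∈ Icc (0:ℝ) 2 → T.R (β n) x ∈ Icc (0:ℝ) 1 := by
    intro n x hx
    have h1 := (T.R_mem_iff _ (hne n) x).1 hx
    rw [(hβ n).2.1] at h1
    have h2 := T.hrs _ (hne n)
    exact ⟨h2.1.trans h1.1, h1.2.trans h2.2.2.1⟩
  have := IsCompact.nonempty_iInter_of_sequence_nonempty_isCompact_isClosed
    (fun n => {x | T.R (β n) x ∈ Icc (0:ℝ) 2})
    (fun n x hx => by
      have := hstep n x hx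
      exact ⟨this.1, by linarith [this.2]⟩)
    (fun n => by
      obtain ⟨x, hx⟩ := T.R_surj (β n) 0
      exact ⟨x, by simp [hx]⟩)
    (T.R_cpt _) (fun n => (T.R_cpt _).isClosed)
  obtain ⟨x, hx⟩ := this
  rw [mem_iInter] at hx
  have hJ : ∀ n, T.J (β n) x := fun n => by
    have := hstep n x (hx (n+1))
    exact ⟨this.1, by linarith [this.2]⟩
  refine ⟨x, ⟨Ico_subset_Icc_self (T.J_unit _ (hne 0) x (hJ 1)), ?_⟩, hJ⟩
  have hb : ∀ n, |T.F x - y| ≤ 2 * (1/2:ℝ)^n := by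
    intro n
    have h1 := T.F_mem _ x (hJ n)
    have h2 := (hβ n).2.2
    have h3 := T.hlen (β n)
    rw [(hβ n).1] at h3
    rw [abs_le]; constructor <;> linarith [h1.1, h1.2, h2.1, h2.2]
  have hl : Filter.Tendsto (fun n : ℕ => 2 * (1/2:ℝ)^n) Filter.atTop (nhds 0) := by
    simpa using (tendsto_pow_atTop_nhds_zero_of_lt_one (r := (1/2:ℝ)) (by norm_num) (by norm_num)).const_mul 2
  have := ge_of_tendsto' hl hb
  have := abs_nonpos_iff.1 this
  linarith

lemma branch_card (y : ℝ) : #(T.Branch y) ≤ #(Sec T.F y) := by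
  choose g hg hJ using T.branch_pt y
  refine Cardinal.mk_le_of_injective (f := fun β : T.Branch y => (⟨g β.1 β.2, hg _ _⟩ : Sec T.F y)) ?_
  intro β γ h
  have h' : g β.1 β.2 = g γ.1 γ.2 := congrArg Subtype.val h
  apply Subtype.ext
  funext n
  refine T.J_dis _ _ (g β.1 β.2) (by rw [(β.2 n).1, (γ.2 n).1]) (hJ _ _ n) ?_
  rw [h']; exact hJ _ _ n

lemma down_range (i : ι) (x y : ℝ) (hF : T.F x = y) (hnf : ¬ (T.a i = y ∧ T.b i = y))
    (h1 : 1 ≤ T.R i x) (h2 : T.R i x < 2) : y ∈ Ioc (T.a i) (T.b i) := by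
  have := T.F_term i x (T.term_of_ge i x h1 h2)
  rw [T.h_down i x h1 h2.le, hF] at this
  rcases eq_or_lt_of_le (T.hab i) with h | h
  · exfalso; apply hnf
    rw [← h] at this ⊢
    constructor <;> linarith
  · constructor <;> nlinarith

lemma up_range (i : ι) (x y : ℝ) (hF : T.F x = y) (hnf : ¬ (T.a i = y ∧ T.b i = y))
    (ht : T.term i x) (h1 : T.R i x < 1) : y ∈ Ico (T.a i) (T.b i) := by
  have := T.F_term i x ht
  rw [T.h_up i x h1.le, hF] at this
  have h3 := T.hPm i (T.R i x)
  rcases eq_or_lt_of_le (T.hab i) with h | h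
  · exfalso; apply hnf
    constructor <;> linarith
  · have := T.hlt i h _ h1
    constructor <;> linarith

lemma up_exists (i : ι) (y : ℝ) (hy : y ∈ Ico (T.a i) (T.b i)) :
    ∃ x, x ∈ Sec T.F y ∧ T.term i x ∧ T.R i x < 1 := by
  obtain ⟨t, ⟨ht, hP, hc⟩, _⟩ := T.huni i y hy
  obtain ⟨x, hx⟩ := T.R_surj i t
  have hJ : T.J i x := ⟨by rw [hx]; exact ht.1, by rw [hx]; linarith [ht.2]⟩
  have hterm : T.term i x := by
    refine ⟨hJ, fun c h1 h2 h3 => hc c h1 h2 ?_⟩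
    have := (T.J_iff c h1 x).1 h3
    rwa [h2, hx] at this
  refine ⟨x, ⟨?_, ?_⟩, hterm, by rw [hx]; exact ht.2⟩
  · by_cases h : i = T.root
    · subst h
      rw [R_root] at hx; rw [hx]; exact Ico_subset_Icc_self ht
    · exact Ico_subset_Icc_self (T.J_unit i h x hJ)
  · rw [T.F_term i x hterm, T.h_up i x (by rw [hx]; exact ht.2.le), hx, hP]; ring

lemma up_unique (i : ι) (y x x' : ℝ) (hy : y ∈ Ico (T.a i) (T.b i)) (hx : T.F x = y) (hx' : T.F x' = y)
    (ht : T.term i x) (ht' : T.term i x') (h : T.R i x < 1) (h' : T.R i x' < 1) : x = x' := by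
  apply T.R_inj i
  have key : ∀ x, T.F x = y → T.term i x → T.R i x < 1 → T.R i x ∈ Ico (0:ℝ) 1 ∧ T.P i (T.R i x) = y ∧
      ∀ c, c ≠ T.root → T.par c = i → T.R i x ∉ Ico (T.r c) (T.s c) := by
    intro x hx ht h
    refine ⟨⟨ht.1.1, h⟩, ?_, ?_⟩
    · have := T.F_term i x ht
      rw [T.h_up i x h.le, hx] at this; linarith
    · rintro c hc rfl hm
      exact ht.2 c hc rfl ((T.J_iff c hc x).2 hm)
  exact (T.huni i y hy).unique (key x hx ht h) (key x' hx' ht' h')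

lemma down_exists (i : ι) (y : ℝ) (hy : y ∈ Ioc (T.a i) (T.b i)) (hr : i = T.root → y = 1) :
    ∃ x, x ∈ Sec T.F y ∧ T.term i x ∧ ¬ T.R i x < 1 := by
  have hl : 0 < T.b i - T.a i := by linarith [hy.1, hy.2]
  have hq1 : (y - T.a i) / (T.b i - T.a i) ≤ 1 := by rw [div_le_one hl]; linarith [hy.2]
  have hq2 : 0 < (y - T.a i) / (T.b i - T.a i) := div_pos (by linarith [hy.1]) hl
  obtain ⟨x, hx⟩ := T.R_surj i (2 - (y - T.a i) / (T.b i - T.a i))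
  have h1 : 1 ≤ T.R i x := by rw [hx]; linarith
  have h2 : T.R i x < 2 := by rw [hx]; linarith
  have ht := T.term_of_ge i x h1 h2
  refine ⟨x, ⟨?_, ?_⟩, ht, not_lt.2 h1⟩
  · by_cases h : i = T.root
    · rw [hr h, h, R_root, T.ha, T.hb] at hx
      rw [hx]; norm_num
    · exact Ico_subset_Icc_self (T.J_unit i h x ht.1)
  · rw [T.F_term i x ht, T.h_down i x h1 h2.le, hx]
    field_simp; ring

lemma down_unique (i : ι) (y x x' : ℝ) (hy : y ∈ Ioc (T.a i) (T.b i)) (hx : T.F x = y) (hx' : T.F x' = y)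
    (ht : T.term i x) (ht' : T.term i x') (h : ¬ T.R i x < 1) (h' : ¬ T.R i x' < 1) : x = x' := by
  apply T.R_inj i
  have hl : 0 < T.b i - T.a i := by linarith [hy.1, hy.2]
  have e := T.F_term i x ht
  have e' := T.F_term i x' ht'
  rw [T.h_down i x (not_lt.1 h) ht.1.2.le, hx] at e
  rw [T.h_down i x' (not_lt.1 h') ht'.1.2.le, hx'] at e'
  have : (2 - T.R i x) * (T.b i - T.a i) = (2 - T.R i x') * (T.b i - T.a i) := by linarith
  have := mul_right_cancel₀ hl.ne' this
  linarith

def Up (y : ℝ) : Set ι := {i | i ≠ T.root ∧ y ∈ Ico (T.a i) (T.b i)}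
def Dn (y : ℝ) : Set ι := {i | i ≠ T.root ∧ y ∈ Ioc (T.a i) (T.b i)}

lemma count (y : ℝ) (hy : y ∈ Icc (0:ℝ) 1) (hnf : ∀ i, ¬ (T.a i = y ∧ T.b i = y))
    (hb : ∀ β, β ∉ T.Branch y) : #(Sec T.F y) = 1 + (#(T.Up y) + #(T.Dn y)) := by
  classical
  let U' : Set ι := {i | y ∈ Ico (T.a i) (T.b i)}
  let D' : Set ι := {i | y ∈ Ioc (T.a i) (T.b i) ∧ (i = T.root → y = 1)}
  have hu : ∀ i : U', ∃ x, x ∈ Sec T.F y ∧ T.term i x ∧ T.R i x < 1 := fun i => T.up_exists i y i.2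
  have hd : ∀ i : D', ∃ x, x ∈ Sec T.F y ∧ T.term i x ∧ ¬ T.R i x < 1 :=
    fun i => T.down_exists i y i.2.1 i.2.2
  choose gu hu1 hu2 hu3 using hu
  choose gd hd1 hd2 hd3 using hd
  have e1 : #(Sec T.F y) = #U' + #D' := by
    rw [Cardinal.add_def]
    symm
    refine Cardinal.mk_congr (Equiv.ofBijective (Sum.elim (fun i => (⟨gu i, hu1 i⟩ : Sec T.F y))
      (fun i => ⟨gd i, hd1 i⟩)) ⟨?_, ?_⟩)
    · rintro (i | i) (j | j) h <;>
        simp only [Sum.elim_inl, Sum.elim_inr, Subtype.mk.injEq] at h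
      · have h2 := hu2 j
        rw [← h] at h2
        rw [Subtype.ext (T.term_unique _ _ _ (hu2 i) h2)]
      · have h2 := hd2 j
        have h3 := hd3 j
        rw [← h] at h2 h3
        rw [← T.term_unique _ _ _ (hu2 i) h2] at h3
        exact absurd (hu3 i) h3
      · have h2 := hd2 i
        have h3 := hd3 i
        rw [h] at h2 h3
        rw [← T.term_unique _ _ _ (hu2 j) h2] at h3
        exact absurd (hu3 j) h3
      · have h2 := hd2 j
        rw [← h] at h2
        rw [Subtype.ext (T.term_unique _ _ _ (hd2 i) h2)]
    · rintro ⟨x, hx⟩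
      obtain ⟨i, hi⟩ := T.exists_term x hx.1 (by rw [hx.2]; exact hb)
      by_cases h : T.R i x < 1
      · have hm : i ∈ U' := T.up_range i x y hx.2 (hnf i) hi h
        refine ⟨Sum.inl ⟨i, hm⟩, Subtype.ext ?_⟩
        exact T.up_unique i y _ x hm (hu1 ⟨i, hm⟩).2 hx.2 (hu2 ⟨i, hm⟩) hi (hu3 ⟨i, hm⟩) h
      · have hm : i ∈ D' := by
          refine ⟨T.down_range i x y hx.2 (hnf i) (not_lt.1 h) hi.1.2, ?_⟩
          rintro rfl
          rw [R_root] at h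
          have : x = 1 := le_antisymm hx.1.2 (not_lt.1 h)
          rw [← hx.2, this, T.F_one]
        refine ⟨Sum.inr ⟨i, hm⟩, Subtype.ext ?_⟩
        exact T.down_unique i y _ x hm.1 (hd1 ⟨i, hm⟩).2 hx.2 (hd2 ⟨i, hm⟩) hi (hd3 ⟨i, hm⟩) h
  rw [e1]
  rcases eq_or_lt_of_le hy.2 with h1 | h1
  · have hU : U' = T.Up y := by
      ext i
      simp only [U', Up, mem_ofPred_eq]
      refine ⟨fun h => ⟨?_, h⟩, fun h => h.2⟩
      rintro rfl
      have := h.2; rw [T.hb] at this; linarith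
    have hD : D' = insert T.root (T.Dn y) := by
      ext i
      simp only [D', Dn, mem_ofPred_eq, mem_insert_iff]
      constructor
      · intro h
        by_cases hi : i = T.root
        · exact Or.inl hi
        · exact Or.inr ⟨hi, h.1⟩
      · rintro (rfl | h)
        · refine ⟨?_, fun _ => h1⟩
          rw [T.ha, T.hb, h1]; norm_num
        · exact ⟨h.2, fun _ => h1⟩
    rw [hU, hD, Cardinal.mk_insert (fun h => h.1 rfl)]
    rw [add_comm, add_right_comm, add_comm _ 1, add_comm (#(T.Dn y))]
  · have hU : U' = insert T.root (T.Up y) := by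
      ext i
      simp only [U', Up, mem_ofPred_eq, mem_insert_iff]
      constructor
      · intro h
        by_cases hi : i = T.root
        · exact Or.inl hi
        · exact Or.inr ⟨hi, h⟩
      · rintro (rfl | h)
        · rw [T.ha, T.hb]; exact ⟨hy.1, h1⟩
        · exact h.2
    have hD : D' = T.Dn y := by
      ext i
      simp only [D', Dn, mem_ofPred_eq]
      exact ⟨fun h => ⟨fun hi => h1.ne (h.2 hi), h.1⟩, fun h => ⟨h.2, fun hi => absurd hi h.1⟩⟩
    rw [hU, hD, Cardinal.mk_insert (fun h => h.1 rfl)]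
    ring

lemma R_zero (i : ι) : T.J i 0 → T.R i 0 = 0 := by
  refine T.ind (fun i => T.J i 0 → T.R i 0 = 0) (fun _ => T.R_root 0) ?_ i
  intro i hi ih hJ
  have h1 := ih (T.J_par i hi 0 hJ).1
  have h2 := (T.J_iff i hi 0).1 hJ
  have h3 := (T.hrs i hi).1
  rw [h1] at h2
  rw [R_succ T i hi, h1, le_antisymm h2.1 h3]; simp

lemma F_zero : T.F 0 = 0 := by
  rw [F]
  convert tsum_zero with n
  by_cases hx : ∃ i, T.d i = n ∧ T.J i 0
  · obtain ⟨i, rfl, hJ⟩ := hx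
    have h0 := T.R_zero i hJ
    rw [T.H_eq i 0 hJ, T.h_up i 0 (by rw [h0]; norm_num), h0, T.hP0 i 0 le_rfl]; ring
  · push Not at hx
    exact T.H_zero n 0 hx

end TD

structure PTree (ι : Type) where
  root : ι
  a : ι → ℝ
  b : ι → ℝ
  par : ι → ι
  d : ι → ℕ
  ha : a root = 0
  hb : b root = 1
  hd0 : ∀ i, d i = 0 ↔ i = root
  hds : ∀ i, i ≠ root → d i = d (par i) + 1
  hpa : ∀ i, i ≠ root → a (par i) ≤ a i
  hpb : ∀ i, i ≠ root → b i ≤ b (par i)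
  hpab : ∀ i, i ≠ root → a i < b (par i)
  hab : ∀ i, a i ≤ b i
  hlen : ∀ i, b i - a i ≤ 2 * (1/2:ℝ)^(d i)
  hfin : ∀ ε > 0, {i | ε ≤ b i - a i}.Finite

def PTree.Branch {ι : Type} (T : PTree ι) (y : ℝ) : Set (ℕ → ι) :=
  {β | ∀ n, T.d (β n) = n ∧ T.par (β (n+1)) = β n ∧ y ∈ Icc (T.a (β n)) (T.b (β n))}

theorem PTree.realize {ι : Type} [Countable ι] (T : PTree ι) :
    ∃ F : ℝ → ℝ, Continuous F ∧ MapsTo F (Icc 0 1) (Icc 0 1) ∧ F 0 = 0 ∧ F 1 = 1 ∧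
      (∀ y i, T.a i = y → T.b i = y → 𝔠 ≤ #(Sec F y)) ∧
      (∀ y, #(T.Branch y) ≤ #(Sec F y)) ∧
      (∀ y ∈ Icc (0:ℝ) 1, (∀ i, ¬ (T.a i = y ∧ T.b i = y)) → (∀ β, β ∉ T.Branch y) →
        #(Sec F y) = 1 + (#{i | i ≠ T.root ∧ y ∈ Ico (T.a i) (T.b i)} +
          #{i | i ≠ T.root ∧ y ∈ Ioc (T.a i) (T.b i)})) := by
  have key := fun i => staircase {j | j ≠ T.root ∧ T.par j = i} T.a (T.a i) (T.b i) (T.hab i)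
    (by rintro c ⟨hc, rfl⟩; exact ⟨T.hpa c hc, T.hpab c hc⟩)
  choose P r s h1 h2 h3 h4 h5 h6 h7 h8 using key
  let D : TD ι :=
    { root := T.root, a := T.a, b := T.b, par := T.par, d := T.d, P := P
      r := fun i => r (T.par i) i, s := fun i => s (T.par i) i
      ha := T.ha, hb := T.hb, hd0 := T.hd0, hds := T.hds, hpa := T.hpa, hpb := T.hpb, hab := T.hab
      hlen := T.hlen, hfin := T.hfin, hPc := h1, hPm := h2, hP0 := h3, hP1 := h4
      hrs := fun i hi => h5 (T.par i) i ⟨hi, rfl⟩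
      hdis := by
        intro i j hi hj hp t ht ht'
        rw [← hp] at ht'
        exact h6 (T.par i) i ⟨hi, rfl⟩ j ⟨hj, hp.symm⟩ t ht ht'
      huni := by
        intro i y hy
        convert h7 i y hy using 2 with t
        simp only [mem_ofPred_eq, and_imp]
        have : (∀ c, c ≠ T.root → T.par c = i → t ∉ Ico (r (T.par c) c) (s (T.par c) c)) ↔
          (∀ c, c ≠ T.root → T.par c = i → t ∉ Ico (r i c) (s i c)) := by
          constructor
          · intro h c hc hp; have := h c hc hp; rwa [hp] at this
          · intro h c hc hp; have := h c hc hp; rwa [hp]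
        rw [this]
      hlt := h8 }
  exact ⟨D.F, D.F_cont, D.F_maps, D.F_zero, D.F_one, D.flat_card, D.branch_card, D.count⟩

section Layers

variable (f : ℝ → Cardinal)

def LU (m : ℕ) : Set ℝ := interior {y | y ∈ Ioo (0:ℝ) 1 ∧ ((2*m+3 : ℕ) : Cardinal) ≤ f y}

def RS (m : ℕ) (y : ℝ) : Prop := ∃ ε > 0, Ioo y (y + ε) ⊆ LU f m
def LS (m : ℕ) (y : ℝ) : Prop := ∃ ε > 0, Ioo (y - ε) y ⊆ LU f m

lemma LU_anti {m m' : ℕ} (h : m ≤ m') : LU f m' ⊆ LU f m := by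
  refine interior_mono ?_
  rintro y ⟨h1, h2⟩
  exact ⟨h1, (Nat.cast_le.2 (by omega)).trans h2⟩

lemma LU_sub (m : ℕ) : LU f m ⊆ Ioo 0 1 := fun _ hy => (interior_subset hy).1

lemma LU_le (m : ℕ) {y : ℝ} (hy : y ∈ LU f m) : ((2*m+3 : ℕ) : Cardinal) ≤ f y := (interior_subset hy).2

lemma RS_anti {m m' : ℕ} (h : m ≤ m') {y : ℝ} : RS f m' y → RS f m y :=
  fun ⟨ε, h1, h2⟩ => ⟨ε, h1, h2.trans (LU_anti f h)⟩

lemma LS_anti {m m' : ℕ} (h : m ≤ m') {y : ℝ} : LS f m' y → LS f m y :=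
  fun ⟨ε, h1, h2⟩ => ⟨ε, h1, h2.trans (LU_anti f h)⟩

lemma RS_of_mem {m : ℕ} {y : ℝ} (h : y ∈ LU f m) : RS f m y ∧ LS f m y := by
  obtain ⟨ε, hε, hb⟩ := Metric.isOpen_iff.1 isOpen_interior y h
  rw [Real.ball_eq_Ioo] at hb
  exact ⟨⟨ε, hε, (Ioo_subset_Ioo_left (by linarith)).trans hb⟩,
    ⟨ε, hε, (Ioo_subset_Ioo_right (by linarith)).trans hb⟩⟩

lemma RS_of {m : ℕ} {y ε : ℝ} (h0 : 0 ≤ y) (h1 : y < 1) (hε : 0 < ε)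
    (h : ∀ z ∈ Icc (0:ℝ) 1, y < z → z < y + ε → ((2*m+3 : ℕ) : Cardinal) ≤ f z) : RS f m y := by
  refine ⟨min ε (1 - y), lt_min hε (by linarith), interior_maximal ?_ isOpen_Ioo⟩
  rintro z ⟨hz1, hz2⟩
  have h3 := min_le_left ε (1 - y)
  have h4 := min_le_right ε (1 - y)
  exact ⟨⟨by linarith, by linarith⟩, h z ⟨by linarith, by linarith⟩ hz1 (by linarith)⟩

lemma LS_of {m : ℕ} {y ε : ℝ} (h0 : 0 < y) (h1 : y ≤ 1) (hε : 0 < ε)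
    (h : ∀ z ∈ Icc (0:ℝ) 1, y - ε < z → z < y → ((2*m+3 : ℕ) : Cardinal) ≤ f z) : LS f m y := by
  refine ⟨min ε y, lt_min hε (by linarith), interior_maximal ?_ isOpen_Ioo⟩
  rintro z ⟨hz1, hz2⟩
  have h3 := min_le_left ε y
  have h4 := min_le_right ε y
  exact ⟨⟨by linarith, by linarith⟩, h z ⟨by linarith, by linarith⟩ (by linarith) hz2⟩

lemma nat_of_lt {c : Cardinal} {m : ℕ} (h : c < ((2*m+3 : ℕ) : Cardinal)) : ∃ k : ℕ, c = k ∧ k ≤ 2*m+2 := by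
  obtain ⟨k, rfl⟩ := Cardinal.lt_aleph0.1 (h.trans (Cardinal.natCast_lt_aleph0))
  exact ⟨k, rfl, by have := Nat.cast_lt.1 h; omega⟩

lemma star_RS_LS {y : ℝ} (hy : y ∈ Icc (0:ℝ) 1) (h : CondStar f y) (m : ℕ) : RS f m y ∨ LS f m y := by
  obtain ⟨ε, hε, h1, h2, h3⟩ := h (4*m+6)
  rcases eq_or_lt_of_le hy.1 with h0 | h0
  · left
    refine RS_of f hy.1 (by linarith) hε (fun z hz hz1 hz2 => ?_)
    have := h2 h0.symm z hz (by linarith) (by linarith)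
    by_contra hc
    obtain ⟨k, hk, hk'⟩ := nat_of_lt (not_le.1 hc)
    rw [hk] at this
    have : 4*m+6 ≤ 1 + k := by exact_mod_cast this
    omega
  rcases eq_or_lt_of_le hy.2 with h0' | h0'
  · right
    refine LS_of f h0 hy.2 hε (fun z hz hz1 hz2 => ?_)
    have := h3 h0' z hz (by linarith) (by linarith)
    by_contra hc
    obtain ⟨k, hk, hk'⟩ := nat_of_lt (not_le.1 hc)
    rw [hk] at this
    have : 4*m+6 ≤ k + 1 := by exact_mod_cast this
    omega
  by_contra hc
  push Not at hc
  obtain ⟨hc1, hc2⟩ := hc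
  have e1 : ∃ z ∈ Icc (0:ℝ) 1, y < z ∧ z < y + ε ∧ f z < ((2*m+3 : ℕ) : Cardinal) := by
    by_contra hh
    push Not at hh
    exact hc1 (RS_of f hy.1 h0' hε hh)
  have e2 : ∃ z ∈ Icc (0:ℝ) 1, y - ε < z ∧ z < y ∧ f z < ((2*m+3 : ℕ) : Cardinal) := by
    by_contra hh
    push Not at hh
    exact hc2 (LS_of f h0 hy.2 hε hh)
  obtain ⟨z, hz, hz1, hz2, hz3⟩ := e1
  obtain ⟨w, hw, hw1, hw2, hw3⟩ := e2
  have := h1 w hw z hz hw1 hw2 hz1 hz2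
  obtain ⟨k, hk, hk'⟩ := nat_of_lt hz3
  obtain ⟨l, hl, hl'⟩ := nat_of_lt hw3
  rw [hk, hl] at this
  have : 4*m+6 ≤ l + k := by exact_mod_cast this
  omega

lemma all_or_all {y : ℝ} (hy : y ∈ Icc (0:ℝ) 1) (h : CondStar f y) :
    (∀ m, RS f m y) ∨ (∀ m, LS f m y) := by
  by_contra hc
  push Not at hc
  obtain ⟨⟨m, hm⟩, ⟨k, hk⟩⟩ := hc
  rcases star_RS_LS f hy h (max m k) with h | h
  · exact hm (RS_anti f (le_max_left _ _) h)
  · exact hk (LS_anti f (le_max_right _ _) h)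

lemma split_fin (hc : Cond1 f) {y : ℝ} (hy : y ∈ Icc (0:ℝ) 1) (n : ℕ) (hn : f y = (n + 1 : ℕ)) :
    ∃ r l : ℕ, r + l = n ∧ (∀ m < r, RS f m y) ∧ (∀ m < l, LS f m y) ∧
      (∀ m, y ∈ LU f m → m < r ∧ m < l) := by
  classical
  obtain ⟨jR, hjRn, hjR, hjR'⟩ : ∃ j ≤ n, (∀ m < j, RS f m y) ∧ (j < n → ¬ RS f j y) := by
    refine ⟨Nat.findGreatest (fun j => ∀ m < j, RS f m y) n, Nat.findGreatest_le n,
      Nat.findGreatest_spec (P := fun j => ∀ m < j, RS f m y) (Nat.zero_le n) (by simp), fun hlt h => ?_⟩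
    refine Nat.findGreatest_is_greatest (P := fun j => ∀ m < j, RS f m y) (Nat.lt_succ_self _) hlt ?_
    intro m hm
    exact RS_anti f (Nat.lt_succ_iff.1 hm) h
  obtain ⟨jL, hjLn, hjL, hjL'⟩ : ∃ j ≤ n, (∀ m < j, LS f m y) ∧ (j < n → ¬ LS f j y) := by
    refine ⟨Nat.findGreatest (fun j => ∀ m < j, LS f m y) n, Nat.findGreatest_le n,
      Nat.findGreatest_spec (P := fun j => ∀ m < j, LS f m y) (Nat.zero_le n) (by simp), fun hlt h => ?_⟩
    refine Nat.findGreatest_is_greatest (P := fun j => ∀ m < j, LS f m y) (Nat.lt_succ_self _) hlt ?_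
    intro m hm
    exact LS_anti f (Nat.lt_succ_iff.1 hm) h
  have hU : ∀ m, y ∈ LU f m → 2 * m + 2 ≤ n := by
    intro m hm
    have := LU_le f m hm
    rw [hn] at this
    have := Nat.cast_le.1 this
    omega
  have hfin : f y < ℵ₀ := by rw [hn]; exact Cardinal.natCast_lt_aleph0
  have key : n ≤ jL + jR := by
    by_contra hlt
    push Not at hlt
    have nR := hjR' (by omega)
    have nL := hjL' (by omega)
    rcases eq_or_lt_of_le hy.1 with h0 | h0
    · subst h0
      obtain ⟨ε, hε, h⟩ := hc.2.1 hfin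
      apply nR
      refine RS_of f le_rfl (by norm_num) hε (fun z hz hz1 hz2 => ?_)
      have := h z hz hz1 (by linarith)
      by_contra hc
      obtain ⟨k, hk, hk'⟩ := nat_of_lt (not_le.1 hc)
      rw [hk, hn] at this
      have : 2 * (n + 1) ≤ 1 + k := by exact_mod_cast this
      omega
    rcases eq_or_lt_of_le hy.2 with h0' | h0'
    · subst h0'
      obtain ⟨ε, hε, h⟩ := hc.2.2 hfin
      apply nL
      refine LS_of f one_pos le_rfl hε (fun z hz hz1 hz2 => ?_)
      have := h z hz hz1 hz2
      by_contra hc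
      obtain ⟨k, hk, hk'⟩ := nat_of_lt (not_le.1 hc)
      rw [hk, hn] at this
      have : 2 * (n + 1) ≤ k + 1 := by exact_mod_cast this
      omega
    obtain ⟨ε, hε, h⟩ := hc.1 y ⟨h0, h0'⟩ hfin
    have e1 : ∃ z ∈ Icc (0:ℝ) 1, y < z ∧ z < y + ε ∧ f z < ((2*jR+3 : ℕ) : Cardinal) := by
      by_contra hh
      push Not at hh
      exact nR (RS_of f hy.1 h0' hε hh)
    have e2 : ∃ z ∈ Icc (0:ℝ) 1, y - ε < z ∧ z < y ∧ f z < ((2*jL+3 : ℕ) : Cardinal) := by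
      by_contra hh
      push Not at hh
      exact nL (LS_of f h0 hy.2 hε hh)
    obtain ⟨z, hz, hz1, hz2, hz3⟩ := e1
    obtain ⟨w, hw, hw1, hw2, hw3⟩ := e2
    obtain ⟨h1, h2⟩ := h w hw z hz hw1 hw2 hz1 hz2
    obtain ⟨k, hk, hk'⟩ := nat_of_lt hz3
    obtain ⟨l, hl, hl'⟩ := nat_of_lt hw3
    rw [hk, hl, hn] at h1 h2
    have h1 : 2 * (n + 1) ≤ l + k := by exact_mod_cast h1
    have hl2 : l = 2*jL+2 := by omega
    obtain ⟨⟨l', e, ho⟩, _⟩ := h2 (by exact_mod_cast (by omega : l + k = 2 * (n+1)))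
    have : l = l' := by exact_mod_cast e
    rw [← this, hl2] at ho
    exact absurd ho (by simp [parity_simps])
  obtain ⟨M, hM1, hM2, hM3⟩ : ∃ M : ℕ, 2 * M ≤ n ∧ (∀ m < M, y ∈ LU f m) ∧ (∀ m, y ∈ LU f m → m < M) := by
    have hex : ∃ m, y ∉ LU f m := ⟨n, fun h => by have := hU n h; omega⟩
    refine ⟨Nat.find hex, ?_, fun m hm => not_not.1 (Nat.find_min hex hm), fun m hm => ?_⟩
    · by_cases h : Nat.find hex = 0
      · omega
      · have := hU _ (not_not.1 (Nat.find_min hex (m := Nat.find hex - 1) (by omega)))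
        omega
    · by_contra hle
      exact Nat.find_spec hex (LU_anti f (not_lt.1 hle) hm)
  have hMR : M ≤ jR := by
    by_contra hlt
    exact hjR' (by omega) (RS_of_mem f (hM2 jR (by omega))).1
  have hML : M ≤ jL := by
    by_contra hlt
    exact hjL' (by omega) (RS_of_mem f (hM2 jL (by omega))).2
  refine ⟨min jR (n - M), n - min jR (n - M), by omega, fun m hm => hjR m (by omega), fun m hm => hjL m (by omega),
    fun m hm => ?_⟩
  have := hM3 m hm
  omega

theorem layers (hf : ∀ y ∈ Icc (0:ℝ) 1, (1 ≤ f y ∧ f y ≤ ℵ₀) ∨ f y = 𝔠)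
    (hc : Cond1 f) (hw : ∀ y ∈ Icc (0:ℝ) 1, f y = ℵ₀ → CondStar f y)
    (S : Set ℝ) (hS : S.Countable) (hSc : ∀ y ∈ Icc (0:ℝ) 1, f y = 𝔠 → y ∉ S → CondStar f y)
    (hSf : S ⊆ {y | f y = 𝔠}) :
    ∃ (U : ℕ → Set ℝ) (S' : Set ℝ) (ro lo : ℕ → ℝ → Prop),
      (∀ m, IsOpen (U m)) ∧ (∀ m m', m ≤ m' → U m' ⊆ U m) ∧ (∀ m, U m ⊆ Ioo 0 1) ∧
      S'.Countable ∧ (∀ y ∈ S', y ∈ Icc (0:ℝ) 1 ∧ f y = 𝔠) ∧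
      (∀ m m' y, m ≤ m' → ro m' y → ro m y) ∧ (∀ m m' y, m ≤ m' → lo m' y → lo m y) ∧
      (∀ m y, y ∈ U m → ro m y ∧ lo m y) ∧
      (∀ m y, ro m y → y ∈ Icc (0:ℝ) 1 ∧ ∃ ε > 0, Ioo y (y + ε) ⊆ U m) ∧
      (∀ m y, lo m y → y ∈ Icc (0:ℝ) 1 ∧ ∃ ε > 0, Ioo (y - ε) y ⊆ U m) ∧
      (∀ y ∈ Icc (0:ℝ) 1, f y = 𝔠 → y ∉ S' → ∀ m, y ∈ U m) ∧
      (∀ y ∈ Icc (0:ℝ) 1, f y ≤ ℵ₀ → f y = 1 + (#{m | ro m y} + #{m | lo m y})) := by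
  classical
  have key : ∀ y ∈ Icc (0:ℝ) 1, ∃ ro lo : ℕ → Prop,
      (∀ m m', m ≤ m' → ro m' → ro m) ∧ (∀ m m', m ≤ m' → lo m' → lo m) ∧
      (∀ m, y ∈ LU f m → ro m ∧ lo m) ∧ (∀ m, ro m → RS f m y) ∧ (∀ m, lo m → LS f m y) ∧
      (f y ≤ ℵ₀ → f y = 1 + (#{m | ro m} + #{m | lo m})) := by
    intro y hy
    rcases hf y hy with ⟨h1, h2⟩ | h
    · rcases eq_or_lt_of_le h2 with h3 | h3
      · refine ⟨fun m => RS f m y, fun m => LS f m y, fun _ _ h => RS_anti f h, fun _ _ h => LS_anti f h,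
          fun m => RS_of_mem f, fun _ h => h, fun _ h => h, fun _ => ?_⟩
        rw [h3]
        have hle : ∀ Q : Set ℕ, #Q ≤ ℵ₀ := fun Q => Cardinal.mk_le_aleph0
        have huniv : #{m : ℕ | True} = ℵ₀ := by
          rw [show {m : ℕ | True} = Set.univ from rfl, Cardinal.mk_univ, Cardinal.mk_nat]
        rcases all_or_all f hy (hw y hy h3) with h | h
        · simp only [h]
          rw [huniv, Cardinal.add_eq_left le_rfl (hle _), Cardinal.add_eq_right le_rfl Cardinal.one_le_aleph0]
        · simp only [h]
          rw [huniv, Cardinal.add_eq_right le_rfl (hle _), Cardinal.add_eq_right le_rfl Cardinal.one_le_aleph0]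
      · obtain ⟨k, hk⟩ := Cardinal.lt_aleph0.1 h3
        have hk1 : 1 ≤ k := by rw [hk] at h1; exact_mod_cast h1
        obtain ⟨n, rfl⟩ : ∃ n, k = n + 1 := ⟨k - 1, by omega⟩
        obtain ⟨r, l, h4, h5, h6, h7⟩ := split_fin f hc hy n hk
        refine ⟨fun m => m < r, fun m => m < l, fun _ _ h h' => h.trans_lt h', fun _ _ h h' => h.trans_lt h',
          h7, h5, h6, fun _ => ?_⟩
        have hcard : ∀ r : ℕ, #{m : ℕ | m < r} = r := by
          intro r
          have : {m : ℕ | m < r} = ((Finset.range r : Finset ℕ) : Set ℕ) := by ext; simp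
          rw [this]; simp
        rw [hcard, hcard, hk, ← h4]; push_cast; ring
    · refine ⟨fun m => y ∈ LU f m, fun m => y ∈ LU f m, fun _ _ h h' => LU_anti f h h', fun _ _ h h' => LU_anti f h h',
        fun _ h => ⟨h, h⟩, fun _ h => (RS_of_mem f h).1, fun _ h => (RS_of_mem f h).2, fun h' => ?_⟩
      rw [h] at h'
      exact absurd h' (not_le.2 Cardinal.aleph0_lt_continuum)
  choose! ro lo k1 k2 k3 k4 k5 k6 using key
  refine ⟨LU f, (S ∩ Icc 0 1) ∪ {y | y ∈ Icc (0:ℝ) 1 ∧ f y = 𝔠 ∧ y ∉ S ∧ ∃ m, y ∉ LU f m},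
    fun m y => y ∈ Icc (0:ℝ) 1 ∧ ro y m, fun m y => y ∈ Icc (0:ℝ) 1 ∧ lo y m,
    fun m => isOpen_interior, fun m m' => LU_anti f, LU_sub f, ?_, ?_,
    fun m m' y h h' => ⟨h'.1, k1 y h'.1 m m' h h'.2⟩, fun m m' y h h' => ⟨h'.1, k2 y h'.1 m m' h h'.2⟩,
    fun m y hy => ?_, fun m y h => ⟨h.1, k4 y h.1 m h.2⟩, fun m y h => ⟨h.1, k5 y h.1 m h.2⟩,
    fun y hy hfy hyS m => ?_, fun y hy hfy => ?_⟩
  · refine (hS.mono inter_subset_left).union ?_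
    have : {y | y ∈ Icc (0:ℝ) 1 ∧ f y = 𝔠 ∧ y ∉ S ∧ ∃ m, y ∉ LU f m} ⊆
        ⋃ m, ({x | x ∈ (LU f m)ᶜ ∧ nhdsWithin x ((LU f m)ᶜ ∩ Ioi x) = ⊥} ∪
          {x | x ∈ (LU f m)ᶜ ∧ nhdsWithin x ((LU f m)ᶜ ∩ Iio x) = ⊥}) := by
      rintro y ⟨hy, hfy, hyS, m, hm⟩
      rw [mem_iUnion]
      refine ⟨m, ?_⟩
      rcases star_RS_LS f hy (hSc y hy hfy hyS) m with ⟨ε, hε, h⟩ | ⟨ε, hε, h⟩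
      · left
        refine ⟨hm, ?_⟩
        rw [← Filter.empty_mem_iff_bot, mem_nhdsWithin]
        refine ⟨Iio (y + ε), isOpen_Iio, by simp [hε], ?_⟩
        rintro z ⟨h1, h2, h3⟩
        exact absurd (h ⟨h3, h1⟩) h2
      · right
        refine ⟨hm, ?_⟩
        rw [← Filter.empty_mem_iff_bot, mem_nhdsWithin]
        refine ⟨Ioi (y - ε), isOpen_Ioi, by simp [hε], ?_⟩
        rintro z ⟨h1, h2, h3⟩
        exact absurd (h ⟨h1, h3⟩) h2
    refine (countable_iUnion (fun m => ?_)).mono this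
    exact countable_setOfPred_isolated_right_within.union countable_setOfPred_isolated_left_within
  · rintro y (⟨h1, h2⟩ | ⟨h1, h2, _⟩)
    · exact ⟨h2, hSf h1⟩
    · exact ⟨h1, h2⟩
  · have hI := Ioo_subset_Icc_self (LU_sub f m hy)
    exact ⟨⟨hI, (k3 y hI m hy).1⟩, ⟨hI, (k3 y hI m hy).2⟩⟩
  · by_contra hm
    by_cases hs : y ∈ S
    · exact hyS (Or.inl ⟨hs, hy⟩)
    · exact hyS (Or.inr ⟨hy, hfy, hs, m, hm⟩)
  · rw [k6 y hy hfy]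
    simp only [hy, true_and]

end Layers

structure LD where
  U : ℕ → Set ℝ
  ro : ℕ → ℝ → Prop
  lo : ℕ → ℝ → Prop
  P : ℕ → Finset ℝ
  hUo : ∀ m, IsOpen (U m)
  hUsub : ∀ m, U m ⊆ Ioo 0 1
  hUanti : ∀ m m', m ≤ m' → U m' ⊆ U m
  hroa : ∀ m m' y, m ≤ m' → ro m' y → ro m y
  hloa : ∀ m m' y, m ≤ m' → lo m' y → lo m y
  hUok : ∀ m y, y ∈ U m → ro m y ∧ lo m y
  hro : ∀ m y, ro m y → y ∈ Icc (0:ℝ) 1 ∧ ∃ ε > 0, Ioo y (y + ε) ⊆ U m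
  hlo : ∀ m y, lo m y → y ∈ Icc (0:ℝ) 1 ∧ ∃ ε > 0, Ioo (y - ε) y ⊆ U m
  hPm : ∀ n n', n ≤ n' → P n ⊆ P n'
  hPI : ∀ n, ∀ p ∈ P n, p ∈ Icc (0:ℝ) 1
  hP0 : ∀ n, (0:ℝ) ∈ P n
  hP1 : ∀ n, (1:ℝ) ∈ P n
  hPl : ∀ n, ∀ p ∈ Ico (0:ℝ) 1, ∃ z ∈ P n, p < z ∧ z ≤ p + (1/2:ℝ)^n
  hPE : ∀ m y, (ro m y ∨ lo m y) → y ∉ U m → ∃ n, y ∈ P n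

lemma exists_LD (U : ℕ → Set ℝ) (ro lo : ℕ → ℝ → Prop)
    (hUo : ∀ m, IsOpen (U m)) (hUanti : ∀ m m', m ≤ m' → U m' ⊆ U m) (hUsub : ∀ m, U m ⊆ Ioo 0 1)
    (hroa : ∀ m m' y, m ≤ m' → ro m' y → ro m y) (hloa : ∀ m m' y, m ≤ m' → lo m' y → lo m y)
    (hUok : ∀ m y, y ∈ U m → ro m y ∧ lo m y)
    (hro : ∀ m y, ro m y → y ∈ Icc (0:ℝ) 1 ∧ ∃ ε > 0, Ioo y (y + ε) ⊆ U m)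
    (hlo : ∀ m y, lo m y → y ∈ Icc (0:ℝ) 1 ∧ ∃ ε > 0, Ioo (y - ε) y ⊆ U m) :
    ∃ L : LD, L.U = U ∧ L.ro = ro ∧ L.lo = lo := by
  classical
  let E : Set ℝ := {y | ∃ m, (ro m y ∨ lo m y) ∧ y ∉ U m}
  have hE : E.Countable := by
    have : E ⊆ ⋃ m, ({x | x ∈ (U m)ᶜ ∧ nhdsWithin x ((U m)ᶜ ∩ Ioi x) = ⊥} ∪
          {x | x ∈ (U m)ᶜ ∧ nhdsWithin x ((U m)ᶜ ∩ Iio x) = ⊥}) := by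
      rintro y ⟨m, h | h, hm⟩
      · obtain ⟨_, ε, hε, h⟩ := hro m y h
        refine mem_iUnion.2 ⟨m, Or.inl ⟨hm, ?_⟩⟩
        rw [← Filter.empty_mem_iff_bot, mem_nhdsWithin]
        refine ⟨Iio (y + ε), isOpen_Iio, by simp [hε], ?_⟩
        rintro z ⟨h1, h2, h3⟩
        exact absurd (h ⟨h3, h1⟩) h2
      · obtain ⟨_, ε, hε, h⟩ := hlo m y h
        refine mem_iUnion.2 ⟨m, Or.inr ⟨hm, ?_⟩⟩
        rw [← Filter.empty_mem_iff_bot, mem_nhdsWithin]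
        refine ⟨Ioi (y - ε), isOpen_Ioi, by simp [hε], ?_⟩
        rintro z ⟨h1, h2, h3⟩
        exact absurd (h ⟨h1, h3⟩) h2
    refine (countable_iUnion (fun m => ?_)).mono this
    exact countable_setOfPred_isolated_right_within.union countable_setOfPred_isolated_left_within
  obtain ⟨e, he⟩ := (hE.insert 0).exists_eq_range (insert_nonempty _ _)
  let Q : ℕ → Finset ℝ := fun n => insert (e n) ((Finset.range (2^n+1)).image (fun k : ℕ => (k:ℝ)/2^n))
  let P : ℕ → Finset ℝ := fun n => ((Finset.range (n+1)).biUnion Q).filter (fun x => x ∈ Icc (0:ℝ) 1)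
  have hP : ∀ n x, x ∈ P n ↔ (∃ k ≤ n, x ∈ Q k) ∧ x ∈ Icc (0:ℝ) 1 := by
    intro n x
    simp only [P, Finset.mem_filter, Finset.mem_biUnion, Finset.mem_range, Nat.lt_succ_iff]
  have hQ : ∀ n k : ℕ, k ≤ 2^n → (k:ℝ)/2^n ∈ P n := by
    intro n k hk
    refine (hP _ _).2 ⟨⟨n, le_rfl, ?_⟩, by positivity, ?_⟩
    · exact Finset.mem_insert_of_mem (Finset.mem_image.2 ⟨k, Finset.mem_range.2 (by omega), rfl⟩)
    · rw [div_le_one (by positivity)]; exact_mod_cast hk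
  refine ⟨⟨U, ro, lo, P, hUo, hUsub, hUanti, hroa, hloa, hUok, hro, hlo, ?_, ?_, ?_, ?_, ?_, ?_⟩, rfl, rfl, rfl⟩
  · intro n n' h x hx
    obtain ⟨⟨k, hk, h1⟩, h2⟩ := (hP _ _).1 hx
    exact (hP _ _).2 ⟨⟨k, hk.trans h, h1⟩, h2⟩
  · intro n p hp; exact ((hP _ _).1 hp).2
  · intro n; simpa using hQ n 0 (Nat.zero_le _)
  · intro n
    have := hQ n (2^n) le_rfl
    rwa [Nat.cast_pow, Nat.cast_ofNat, div_self (by positivity)] at this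
  · intro n p hp
    have h2 : (0:ℝ) < 2^n := by positivity
    have hf1 := Nat.floor_le (show 0 ≤ p * 2^n from mul_nonneg hp.1 h2.le)
    have hf2 := Nat.lt_floor_add_one (p * 2^n)
    have hlt : (⌊p * 2^n⌋₊ : ℝ) < 2^n := hf1.trans_lt (by nlinarith [hp.2])
    have hlt' : ⌊p * 2^n⌋₊ < 2^n := by exact_mod_cast hlt
    refine ⟨_, hQ n (⌊p * 2^n⌋₊ + 1) hlt', ?_, ?_⟩
    · rw [lt_div_iff₀ h2]; push_cast; exact hf2
    · rw [div_le_iff₀ h2, add_mul, ← mul_pow]; push_cast; norm_num; exact hf1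
  · intro m y h hm
    have : y ∈ insert 0 E := Or.inr ⟨m, h, hm⟩
    rw [he] at this
    obtain ⟨n, rfl⟩ := this
    refine ⟨n, (hP _ _).2 ⟨⟨n, le_rfl, Finset.mem_insert_self _ _⟩, ?_⟩⟩
    rcases h with h | h
    · exact (hro m _ h).1
    · exact (hlo m _ h).1

namespace LD

variable (L : LD)

def Cell (n : ℕ) (p q : ℝ) : Prop := p ∈ L.P n ∧ q ∈ L.P n ∧ p < q ∧ ∀ z ∈ L.P n, ¬ (p < z ∧ z < q)

lemma cell_unit {n : ℕ} {p q : ℝ} (h : L.Cell n p q) : 0 ≤ p ∧ q ≤ 1 :=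
  ⟨(L.hPI n p h.1).1, (L.hPI n q h.2.1).2⟩

lemma cell_len {n : ℕ} {p q : ℝ} (h : L.Cell n p q) : q - p ≤ (1/2:ℝ)^n := by
  obtain ⟨h0, h1⟩ := L.cell_unit h
  obtain ⟨z, hz, h2, h3⟩ := L.hPl n p ⟨h0, h.2.2.1.trans_le h1⟩
  have := h.2.2.2 z hz
  have : q ≤ z := by by_contra hc; exact this ⟨h2, not_le.1 hc⟩
  linarith

lemma cellR (n : ℕ) (y : ℝ) (hy : y ∈ Ico (0:ℝ) 1) : ∃ p q, L.Cell n p q ∧ y ∈ Ico p q := by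
  classical
  have n1 : ((L.P n).filter (fun z => z ≤ y)).Nonempty := ⟨0, Finset.mem_filter.2 ⟨L.hP0 n, hy.1⟩⟩
  have n2 : ((L.P n).filter (fun z => y < z)).Nonempty := ⟨1, Finset.mem_filter.2 ⟨L.hP1 n, hy.2⟩⟩
  have h1 := Finset.mem_filter.1 (Finset.max'_mem _ n1)
  have h2 := Finset.mem_filter.1 (Finset.min'_mem _ n2)
  refine ⟨_, _, ⟨h1.1, h2.1, h1.2.trans_lt h2.2, ?_⟩, h1.2, h2.2⟩
  rintro z hz ⟨h3, h4⟩
  rcases le_or_gt z y with h | h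
  · exact absurd (Finset.le_max' _ z (Finset.mem_filter.2 ⟨hz, h⟩)) (not_le.2 h3)
  · exact absurd (Finset.min'_le _ z (Finset.mem_filter.2 ⟨hz, h⟩)) (not_le.2 h4)

lemma cellL (n : ℕ) (y : ℝ) (hy : y ∈ Ioc (0:ℝ) 1) : ∃ p q, L.Cell n p q ∧ y ∈ Ioc p q := by
  classical
  have n1 : ((L.P n).filter (fun z => z < y)).Nonempty := ⟨0, Finset.mem_filter.2 ⟨L.hP0 n, hy.1⟩⟩
  have n2 : ((L.P n).filter (fun z => y ≤ z)).Nonempty := ⟨1, Finset.mem_filter.2 ⟨L.hP1 n, hy.2⟩⟩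
  have h1 := Finset.mem_filter.1 (Finset.max'_mem _ n1)
  have h2 := Finset.mem_filter.1 (Finset.min'_mem _ n2)
  refine ⟨_, _, ⟨h1.1, h2.1, h1.2.trans_le h2.2, ?_⟩, h1.2, h2.2⟩
  rintro z hz ⟨h3, h4⟩
  rcases lt_or_ge z y with h | h
  · exact absurd (Finset.le_max' _ z (Finset.mem_filter.2 ⟨hz, h⟩)) (not_le.2 h3)
  · exact absurd (Finset.min'_le _ z (Finset.mem_filter.2 ⟨hz, h⟩)) (not_le.2 h4)

lemma cell_lam {n n' : ℕ} {p q p' q' : ℝ} (h : L.Cell n p q) (h' : L.Cell n' p' q') (hn : n ≤ n')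
    (ho1 : p < q') (ho2 : p' < q) : p ≤ p' ∧ q' ≤ q := by
  have h1 := h'.2.2.2 p (L.hPm n n' hn h.1)
  have h2 := h'.2.2.2 q (L.hPm n n' hn h.2.1)
  constructor
  · by_contra hc; exact h1 ⟨not_le.1 hc, ho1⟩
  · by_contra hc; exact h2 ⟨ho2, not_le.1 hc⟩

def Good (m : ℕ) (p q : ℝ) : Prop := Ioo p q ⊆ L.U m ∧ L.ro m p ∧ L.lo m q ∧ q - p ≤ (1/2:ℝ)^m

lemma good_anti {m m' : ℕ} (h : m ≤ m') {p q : ℝ} (hg : L.Good m' p q) : L.Good m p q :=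
  ⟨hg.1.trans (L.hUanti m m' h), L.hroa m m' p h hg.2.1, L.hloa m m' q h hg.2.2.1,
    hg.2.2.2.trans (pow_le_pow_of_le_one (by norm_num) (by norm_num) h)⟩

def IsTile (m : ℕ) (p q : ℝ) : Prop := (∃ n, L.Cell n p q) ∧ L.Good m p q ∧
  ∀ n' p' q', L.Cell n' p' q' → L.Good m p' q' → p' ≤ p → q ≤ q' → p' = p ∧ q' = q

lemma tile_lt {m : ℕ} {p q : ℝ} (h : L.IsTile m p q) : p < q := by
  obtain ⟨n, hn⟩ := h.1; exact hn.2.2.1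

lemma tile_unit {m : ℕ} {p q : ℝ} (h : L.IsTile m p q) : 0 ≤ p ∧ q ≤ 1 := by
  obtain ⟨n, hn⟩ := h.1; exact L.cell_unit hn

/-- a good cell overlapping a tile is contained in it -/
lemma tile_max {m n : ℕ} {p q p' q' : ℝ} (h : L.IsTile m p q) (hc : L.Cell n p' q') (hg : L.Good m p' q')
    (h1 : p < q') (h2 : p' < q) : p ≤ p' ∧ q' ≤ q := by
  obtain ⟨k, hk⟩ := h.1
  rcases le_total k n with hkn | hkn
  · exact L.cell_lam hk hc hkn h1 h2
  · have := L.cell_lam hc hk hkn h2 h1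
    have e := h.2.2 n p' q' hc hg this.1 this.2
    rw [e.1, e.2]; exact ⟨le_rfl, le_rfl⟩

lemma tile_uniq {m : ℕ} {p q p' q' : ℝ} (h : L.IsTile m p q) (h' : L.IsTile m p' q')
    (h1 : p < q') (h2 : p' < q) : p = p' ∧ q = q' := by
  obtain ⟨k, hk⟩ := h.1
  obtain ⟨k', hk'⟩ := h'.1
  have e1 := L.tile_max h hk' h'.2.1 h1 h2
  have e2 := L.tile_max h' hk h.2.1 h2 h1
  exact ⟨le_antisymm e1.1 e2.1, le_antisymm e2.2 e1.2⟩

lemma tile_of_good {m n : ℕ} {p q : ℝ} (hc : L.Cell n p q) (hg : L.Good m p q) :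
    ∃ p' q', L.IsTile m p' q' ∧ p' ≤ p ∧ q ≤ q' := by
  classical
  have hex : ∃ k, ∃ p' q', L.Cell k p' q' ∧ L.Good m p' q' ∧ p' ≤ p ∧ q ≤ q' := ⟨n, p, q, hc, hg, le_rfl, le_rfl⟩
  obtain ⟨p', q', h1, h2, h3, h4⟩ := Nat.find_spec hex
  refine ⟨p', q', ⟨⟨_, h1⟩, h2, ?_⟩, h3, h4⟩
  intro n' p'' q'' hc' hg' h5 h6
  have hle : Nat.find hex ≤ n' := Nat.find_min' hex ⟨p'', q'', hc', hg', h5.trans h3, h4.trans h6⟩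
  have hlt := h1.2.2.1
  have := L.cell_lam h1 hc' hle (by linarith) (by linarith)
  exact ⟨le_antisymm h5 this.1, le_antisymm this.2 h6⟩

lemma exists_n (m n0 : ℕ) {ε : ℝ} (hε : 0 < ε) : ∃ n, m ≤ n ∧ n0 ≤ n ∧ (1/2:ℝ)^n < ε := by
  obtain ⟨k, hk⟩ := exists_pow_lt_of_lt_one hε (show (1/2:ℝ) < 1 by norm_num)
  refine ⟨max m (max n0 k), le_max_left _ _, (le_max_left _ _).trans (le_max_right _ _), lt_of_le_of_lt ?_ hk⟩
  exact pow_le_pow_of_le_one (by norm_num) (by norm_num) ((le_max_right _ _).trans (le_max_right _ _))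

lemma good_inner {m n : ℕ} {p q y : ℝ} {ε : ℝ} (hb : Ioo (y - ε) (y + ε) ⊆ L.U m)
    (hmn : m ≤ n) (hn : (1/2:ℝ)^n < ε) (hc : L.Cell n p q) (h : y ∈ Icc p q) : L.Good m p q := by
  have hl := L.cell_len hc
  have hsub : Icc p q ⊆ L.U m := fun z hz => hb ⟨by linarith [hz.1, h.2], by linarith [hz.2, h.1]⟩
  have hlt := hc.2.2.1
  exact ⟨Ioo_subset_Icc_self.trans hsub, (L.hUok m p (hsub ⟨le_rfl, hlt.le⟩)).1,
    (L.hUok m q (hsub ⟨hlt.le, le_rfl⟩)).2,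
    hl.trans (pow_le_pow_of_le_one (by norm_num) (by norm_num) hmn)⟩

lemma tileR_iff (m : ℕ) (y : ℝ) : L.ro m y ↔ ∃ p q, L.IsTile m p q ∧ y ∈ Ico p q := by
  constructor
  · intro h
    suffices hs : ∃ n p q, L.Cell n p q ∧ L.Good m p q ∧ y ∈ Ico p q by
      obtain ⟨n, p, q, h1, h2, h3⟩ := hs
      obtain ⟨p', q', h4, h5, h6⟩ := L.tile_of_good h1 h2
      exact ⟨p', q', h4, h5.trans h3.1, h3.2.trans_le h6⟩
    obtain ⟨hI, ε, hε, hs⟩ := L.hro m y h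
    have hy1 : y < 1 := by
      have := (L.hUsub m (hs (show y + ε/2 ∈ Ioo y (y + ε) from ⟨by linarith, by linarith⟩))).2
      linarith
    by_cases hU : y ∈ L.U m
    · obtain ⟨δ, hδ, hb⟩ := Metric.isOpen_iff.1 (L.hUo m) y hU
      rw [Real.ball_eq_Ioo] at hb
      obtain ⟨n, hn1, _, hn2⟩ := exists_n m 0 hδ
      obtain ⟨p, q, hc, hpq⟩ := L.cellR n y ⟨hI.1, hy1⟩
      exact ⟨n, p, q, hc, L.good_inner hb hn1 hn2 hc (Ico_subset_Icc_self hpq), hpq⟩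
    · obtain ⟨n0, hn0⟩ := L.hPE m y (Or.inl h) hU
      obtain ⟨n, hn1, hn3, hn2⟩ := exists_n m n0 hε
      obtain ⟨p, q, hc, hpq⟩ := L.cellR n y ⟨hI.1, hy1⟩
      have hyp : p = y := by
        by_contra hne
        exact hc.2.2.2 y (L.hPm _ _ hn3 hn0) ⟨lt_of_le_of_ne hpq.1 hne, hpq.2⟩
      subst hyp
      have hl := L.cell_len hc
      refine ⟨n, p, q, hc, ⟨fun z hz => hs ⟨hz.1, by linarith [hz.2]⟩, h,
        (L.hUok m q (hs ⟨hpq.2, by linarith⟩)).2,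
        hl.trans (pow_le_pow_of_le_one (by norm_num) (by norm_num) hn1)⟩, hpq⟩
  · rintro ⟨p, q, h, hy⟩
    rcases eq_or_lt_of_le hy.1 with h1 | h1
    · rw [← h1]; exact h.2.1.2.1
    · exact (L.hUok m y (h.2.1.1 ⟨h1, hy.2⟩)).1

lemma tileL_iff (m : ℕ) (y : ℝ) : L.lo m y ↔ ∃ p q, L.IsTile m p q ∧ y ∈ Ioc p q := by
  constructor
  · intro h
    suffices hs : ∃ n p q, L.Cell n p q ∧ L.Good m p q ∧ y ∈ Ioc p q by
      obtain ⟨n, p, q, h1, h2, h3⟩ := hs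
      obtain ⟨p', q', h4, h5, h6⟩ := L.tile_of_good h1 h2
      exact ⟨p', q', h4, h5.trans_lt h3.1, h3.2.trans h6⟩
    obtain ⟨hI, ε, hε, hs⟩ := L.hlo m y h
    have hy1 : 0 < y := by
      have := (L.hUsub m (hs (show y - ε/2 ∈ Ioo (y - ε) y from ⟨by linarith, by linarith⟩))).1
      linarith
    by_cases hU : y ∈ L.U m
    · obtain ⟨δ, hδ, hb⟩ := Metric.isOpen_iff.1 (L.hUo m) y hU
      rw [Real.ball_eq_Ioo] at hb
      obtain ⟨n, hn1, _, hn2⟩ := exists_n m 0 hδ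
      obtain ⟨p, q, hc, hpq⟩ := L.cellL n y ⟨hy1, hI.2⟩
      exact ⟨n, p, q, hc, L.good_inner hb hn1 hn2 hc (Ioc_subset_Icc_self hpq), hpq⟩
    · obtain ⟨n0, hn0⟩ := L.hPE m y (Or.inr h) hU
      obtain ⟨n, hn1, hn3, hn2⟩ := exists_n m n0 hε
      obtain ⟨p, q, hc, hpq⟩ := L.cellL n y ⟨hy1, hI.2⟩
      have hyp : y = q := by
        by_contra hne
        exact hc.2.2.2 y (L.hPm _ _ hn3 hn0) ⟨hpq.1, lt_of_le_of_ne hpq.2 hne⟩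
      subst hyp
      have hl := L.cell_len hc
      refine ⟨n, p, y, hc, ⟨fun z hz => hs ⟨by linarith [hz.1], hz.2⟩, 
        (L.hUok m p (hs ⟨by linarith, hpq.1⟩)).1, h,
        hl.trans (pow_le_pow_of_le_one (by norm_num) (by norm_num) hn1)⟩, hpq⟩
  · rintro ⟨p, q, h, hy⟩
    rcases eq_or_lt_of_le hy.2 with h1 | h1
    · rw [h1]; exact h.2.1.2.2.1
    · exact (L.hUok m y (h.2.1.1 ⟨hy.1, h1⟩)).2

end LD

lemma enc_lt (k : ℕ) (s : List ℕ) : Encodable.encode s < Encodable.encode (k :: s) := by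
  rw [Encodable.encode_list_cons]
  exact Nat.lt_succ_of_le (Nat.right_le_pair _ _)

lemma len_le_enc (s : List ℕ) : s.length ≤ Encodable.encode s := by
  induction s with
  | nil => simp
  | cons k s ih => have := enc_lt k s; simp only [List.length_cons]; omega

namespace LD

variable (L : LD)

def Tl : Set (List ℕ × ℝ × ℝ) := {t | L.IsTile (Encodable.encode t.1) t.2.1 t.2.2}

lemma Tl_countable : L.Tl.Countable := by
  have hc : (⋃ n, (L.P n : Set ℝ)).Countable := countable_iUnion (fun n => (L.P n).countable_toSet)
  refine ((countable_univ (α := List ℕ)).prod (hc.prod hc)).mono ?_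
  rintro ⟨s, p, q⟩ h
  obtain ⟨n, hn⟩ := h.1
  exact ⟨mem_univ _, mem_iUnion.2 ⟨n, hn.1⟩, mem_iUnion.2 ⟨n, hn.2.1⟩⟩

instance : Countable L.Tl := L.Tl_countable.to_subtype

lemma exists_pt : ∃ pt : L.Tl → L.Tl, ∀ t k s, t.1.1 = k :: s →
    (pt t).1.1 = s ∧ (pt t).1.2.1 ≤ t.1.2.1 ∧ t.1.2.2 ≤ (pt t).1.2.2 := by
  have : ∀ t : L.Tl, ∃ t' : L.Tl, ∀ k s, t.1.1 = k :: s →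
      t'.1.1 = s ∧ t'.1.2.1 ≤ t.1.2.1 ∧ t.1.2.2 ≤ t'.1.2.2 := by
    rintro ⟨⟨s, p, q⟩, ht⟩
    cases s with
    | nil => exact ⟨⟨⟨[], p, q⟩, ht⟩, by simp⟩
    | cons k s =>
      obtain ⟨n, hn⟩ := ht.1
      obtain ⟨p', q', h1, h2, h3⟩ := L.tile_of_good hn (L.good_anti (enc_lt k s).le ht.2.1)
      refine ⟨⟨⟨s, p', q'⟩, h1⟩, ?_⟩
      intro k' s' h
      simp only [List.cons.injEq] at h
      exact ⟨h.2, h2, h3⟩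
  choose pt hpt using this
  exact ⟨pt, hpt⟩

variable (Fl : Set ℝ) (B : List ℕ → Set ℝ) (pt : L.Tl → L.Tl)

def Meets (t : L.Tl) : Prop := ∃ y ∈ B t.1.1, y ∈ Icc t.1.2.1 t.1.2.2

def na : Option (Fl ⊕ L.Tl) → ℝ
  | none => 0
  | some (Sum.inl y) => y
  | some (Sum.inr t) => t.1.2.1

def nb : Option (Fl ⊕ L.Tl) → ℝ
  | none => 1
  | some (Sum.inl y) => y
  | some (Sum.inr t) => t.1.2.2

open Classical in
def npar : Option (Fl ⊕ L.Tl) → Option (Fl ⊕ L.Tl)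
  | none => none
  | some (Sum.inl _) => none
  | some (Sum.inr t) => if L.Meets B t ∧ t.1.1 ≠ [] then some (Sum.inr (pt t)) else none

open Classical in
def nd : Option (Fl ⊕ L.Tl) → ℕ
  | none => 0
  | some (Sum.inl _) => 1
  | some (Sum.inr t) => if L.Meets B t then t.1.1.length + 1 else 1

def mkTree (hFl : ∀ y ∈ Fl, y ∈ Ico (0:ℝ) 1) (hB : ∀ k s, B (k :: s) ⊆ B s)
    (hpt : ∀ t k s, t.1.1 = k :: s →
      (pt t).1.1 = s ∧ (pt t).1.2.1 ≤ t.1.2.1 ∧ t.1.2.2 ≤ (pt t).1.2.2) :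
    PTree (Option (Fl ⊕ L.Tl)) where
  root := none
  a := L.na Fl
  b := L.nb Fl
  par := L.npar Fl B pt
  d := L.nd Fl B
  ha := rfl
  hb := rfl
  hd0 := by
    rintro (_ | y | t)
    · simp [nd]
    · simp [nd]
    · simp only [nd]; split_ifs <;> simp
  hds := by
    rintro (_ | y | t) h
    · exact absurd rfl h
    · rfl
    · simp only [nd, npar]
      by_cases hm : L.Meets B t
      · rcases hs : t.1.1 with _ | ⟨k, s⟩
        · simp [hm]
        · obtain ⟨h1, h2, h3⟩ := hpt t k s hs
          have hm' : L.Meets B (pt t) := by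
            obtain ⟨y, hy, hy'⟩ := hm
            rw [hs] at hy
            exact ⟨y, by rw [h1]; exact hB k s hy, h2.trans hy'.1, hy'.2.trans h3⟩
          simp [hm, hm', h1]
      · simp [hm]
  hpa := by
    rintro (_ | y | t) h
    · exact absurd rfl h
    · exact (hFl y y.2).1
    · simp only [npar]
      split_ifs with hc
      · obtain ⟨k, s, hs⟩ := List.exists_cons_of_ne_nil hc.2
        exact (hpt t k s hs).2.1
      · exact (L.tile_unit t.2).1
  hpb := by
    rintro (_ | y | t) h
    · exact absurd rfl h
    · exact (hFl y y.2).2.le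
    · simp only [npar]
      split_ifs with hc
      · obtain ⟨k, s, hs⟩ := List.exists_cons_of_ne_nil hc.2
        exact (hpt t k s hs).2.2
      · exact (L.tile_unit t.2).2
  hpab := by
    rintro (_ | y | t) h
    · exact absurd rfl h
    · exact (hFl y y.2).2
    · have hlt := L.tile_lt t.2
      simp only [npar]
      split_ifs with hc
      · obtain ⟨k, s, hs⟩ := List.exists_cons_of_ne_nil hc.2
        exact hlt.trans_le (hpt t k s hs).2.2
      · exact hlt.trans_le (L.tile_unit t.2).2
  hab := by
    rintro (_ | y | t)
    · exact zero_le_one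
    · exact le_rfl
    · exact (L.tile_lt t.2).le
  hlen := by
    rintro (_ | y | t)
    · simp [na, nb, nd]
    · simp [na, nb, nd]
    · have h1 := t.2.2.1.2.2.2
      have h2 := L.tile_unit t.2
      simp only [na, nb, nd]
      split_ifs with hc
      · have h3 : (1/2:ℝ)^(Encodable.encode t.1.1) ≤ (1/2:ℝ)^t.1.1.length :=
          pow_le_pow_of_le_one (by norm_num) (by norm_num) (len_le_enc _)
        rw [pow_succ]; linarith
      · norm_num; linarith
  hfin := by
    intro ε hε
    obtain ⟨N, _, _, hN⟩ := exists_n 0 0 hε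
    have hf1 : {s : List ℕ | Encodable.encode s ≤ N}.Finite :=
      Set.Finite.of_finite_image (f := Encodable.encode)
        ((Set.finite_Iic N).subset (by rintro _ ⟨s, hs, rfl⟩; exact hs)) Encodable.encode_injective.injOn
    have hf2 := hf1.prod ((L.P N).finite_toSet.prod (L.P N).finite_toSet)
    have hf3 : {t : L.Tl | ε ≤ t.1.2.2 - t.1.2.1}.Finite := by
      refine Set.Finite.of_finite_image (f := Subtype.val) (hf2.subset ?_) Subtype.val_injective.injOn
      rintro _ ⟨⟨⟨s, p, q⟩, ht⟩, h, rfl⟩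
      have h : ε ≤ q - p := h
      obtain ⟨n, hn⟩ := ht.1
      have hl := L.cell_len hn
      have hl' := ht.2.1.2.2.2
      have hnN : n ≤ N := by
        by_contra hc
        have := pow_le_pow_of_le_one (a := (1/2:ℝ)) (by norm_num) (by norm_num) (not_le.1 hc).le
        simp only at hl
        linarith
      have hsN : Encodable.encode s ≤ N := by
        by_contra hc
        have := pow_le_pow_of_le_one (a := (1/2:ℝ)) (by norm_num) (by norm_num) (not_le.1 hc).le
        simp only at hl'
        linarith
      exact ⟨hsN, L.hPm _ _ hnN hn.1, L.hPm _ _ hnN hn.2.1⟩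
    refine ((Set.finite_singleton (none : Option (Fl ⊕ L.Tl))).union (hf3.image (fun t => some (Sum.inr t)))).subset ?_
    rintro (_ | y | t) h
    · exact Or.inl rfl
    · exfalso
      have : ε ≤ (y:ℝ) - y := h
      linarith
    · exact Or.inr ⟨t, h, rfl⟩

variable (hFl : ∀ y ∈ Fl, y ∈ Ico (0:ℝ) 1) (hB : ∀ k s, B (k :: s) ⊆ B s)
    (hpt : ∀ t k s, t.1.1 = k :: s →
      (pt t).1.1 = s ∧ (pt t).1.2.1 ≤ t.1.2.1 ∧ t.1.2.2 ≤ (pt t).1.2.2)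

lemma up_card (y : ℝ) : #{i | i ≠ (L.mkTree Fl B pt hFl hB hpt).root ∧
      y ∈ Ico ((L.mkTree Fl B pt hFl hB hpt).a i) ((L.mkTree Fl B pt hFl hB hpt).b i)} = #{m | L.ro m y} := by
  symm
  have key : ∀ m : {m | L.ro m y}, ∃ t : L.Tl, Encodable.encode t.1.1 = m.1 ∧ y ∈ Ico t.1.2.1 t.1.2.2 := by
    rintro ⟨m, hm⟩
    obtain ⟨p, q, h1, h2⟩ := (L.tileR_iff m y).1 hm
    exact ⟨⟨⟨Denumerable.ofNat (List ℕ) m, p, q⟩, by rw [Tl, mem_ofPred_eq, Denumerable.encode_ofNat]; exact h1⟩,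
      Denumerable.encode_ofNat m, h2⟩
  choose g hg1 hg2 using key
  refine Cardinal.mk_congr (Equiv.ofBijective (fun m => ⟨some (Sum.inr (g m)), ⟨by simp [mkTree], hg2 m⟩⟩) ⟨?_, ?_⟩)
  · intro m m' h
    simp only [Subtype.mk.injEq, Option.some.injEq, Sum.inr.injEq] at h
    apply Subtype.ext
    rw [← hg1, ← hg1, h]
  · rintro ⟨(_ | z | t), h, h'⟩
    · exact absurd rfl h
    · exfalso
      have h1 : (z:ℝ) ≤ y := h'.1
      have h2 : y < (z:ℝ) := h'.2
      linarith
    · have h' : y ∈ Ico t.1.2.1 t.1.2.2 := h'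
      have hm : L.ro (Encodable.encode t.1.1) y := (L.tileR_iff _ y).2 ⟨_, _, t.2, h'⟩
      refine ⟨⟨_, hm⟩, ?_⟩
      simp only [Subtype.mk.injEq, Option.some.injEq, Sum.inr.injEq]
      have e1 := hg1 ⟨_, hm⟩
      have e2 := hg2 ⟨_, hm⟩
      have e3 : L.IsTile (Encodable.encode (g ⟨_, hm⟩).1.1) _ _ := (g ⟨_, hm⟩).2
      rw [e1] at e3
      have e4 := L.tile_uniq e3 t.2 (e2.1.trans_lt h'.2) (h'.1.trans_lt e2.2)
      apply Subtype.ext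
      exact Prod.ext (Encodable.encode_injective e1) (Prod.ext e4.1 e4.2)

lemma dn_card (y : ℝ) : #{i | i ≠ (L.mkTree Fl B pt hFl hB hpt).root ∧
      y ∈ Ioc ((L.mkTree Fl B pt hFl hB hpt).a i) ((L.mkTree Fl B pt hFl hB hpt).b i)} = #{m | L.lo m y} := by
  symm
  have key : ∀ m : {m | L.lo m y}, ∃ t : L.Tl, Encodable.encode t.1.1 = m.1 ∧ y ∈ Ioc t.1.2.1 t.1.2.2 := by
    rintro ⟨m, hm⟩
    obtain ⟨p, q, h1, h2⟩ := (L.tileL_iff m y).1 hm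
    exact ⟨⟨⟨Denumerable.ofNat (List ℕ) m, p, q⟩, by rw [Tl, mem_ofPred_eq, Denumerable.encode_ofNat]; exact h1⟩,
      Denumerable.encode_ofNat m, h2⟩
  choose g hg1 hg2 using key
  refine Cardinal.mk_congr (Equiv.ofBijective (fun m => ⟨some (Sum.inr (g m)), ⟨by simp [mkTree], hg2 m⟩⟩) ⟨?_, ?_⟩)
  · intro m m' h
    simp only [Subtype.mk.injEq, Option.some.injEq, Sum.inr.injEq] at h
    apply Subtype.ext
    rw [← hg1, ← hg1, h]
  · rintro ⟨(_ | z | t), h, h'⟩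
    · exact absurd rfl h
    · exfalso
      have h1 : (z:ℝ) < y := h'.1
      have h2 : y ≤ (z:ℝ) := h'.2
      linarith
    · have h' : y ∈ Ioc t.1.2.1 t.1.2.2 := h'
      have hm : L.lo (Encodable.encode t.1.1) y := (L.tileL_iff _ y).2 ⟨_, _, t.2, h'⟩
      refine ⟨⟨_, hm⟩, ?_⟩
      simp only [Subtype.mk.injEq, Option.some.injEq, Sum.inr.injEq]
      have e1 := hg1 ⟨_, hm⟩
      have e2 := hg2 ⟨_, hm⟩
      have e3 : L.IsTile (Encodable.encode (g ⟨_, hm⟩).1.1) _ _ := (g ⟨_, hm⟩).2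
      rw [e1] at e3
      have e4 := L.tile_uniq e3 t.2 (e2.1.trans_le h'.2) (h'.1.trans_le e2.2)
      apply Subtype.ext
      exact Prod.ext (Encodable.encode_injective e1) (Prod.ext e4.1 e4.2)

lemma branch_back (y : ℝ) (β : ℕ → Option (Fl ⊕ L.Tl)) (hβ : β ∈ (L.mkTree Fl B pt hFl hB hpt).Branch y) :
    ∃ (σ : ℕ → ℕ) (z : ℕ → ℝ), (∀ n, z n ∈ B (PiNat.res σ n)) ∧ (∀ n, |z n - y| ≤ (1/2:ℝ)^n) := by
  have hd : ∀ n, L.nd Fl B (β n) = n := fun n => (hβ n).1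
  have hp : ∀ n, L.npar Fl B pt (β (n+1)) = β n := fun n => (hβ n).2.1
  have hy : ∀ n, y ∈ Icc (L.na Fl (β n)) (L.nb Fl (β n)) := fun n => (hβ n).2.2
  have h2 : ∀ n, ∃ t, β (n+2) = some (Sum.inr t) ∧ L.Meets B t ∧ t.1.1 ≠ [] ∧ β (n+1) = some (Sum.inr (pt t)) := by
    intro n
    have h1 := hd (n+2)
    have h3 := hp (n+1)
    rcases hb : β (n+2) with _ | z | t
    · rw [hb] at h1; simp [nd] at h1
    · rw [hb] at h1; simp [nd] at h1
    · rw [hb] at h1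
      rw [show n + 1 + 1 = n + 2 from rfl, hb] at h3
      simp only [nd] at h1
      simp only [npar] at h3
      by_cases hm : L.Meets B t
      · have hne : t.1.1 ≠ [] := by
          intro h; rw [if_pos hm, h] at h1; simp at h1
        rw [if_pos ⟨hm, hne⟩] at h3
        exact ⟨t, rfl, hm, hne, h3.symm⟩
      · rw [if_neg hm] at h1; omega
  choose t ht1 ht2 ht3 ht4 using h2
  have h3 : ∀ n, ∃ u, β (n+1) = some (Sum.inr u) ∧ L.Meets B u := by
    intro n
    cases n with
    | zero =>
      refine ⟨pt (t 0), ht4 0, ?_⟩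
      obtain ⟨k, s, hs⟩ := List.exists_cons_of_ne_nil (ht3 0)
      obtain ⟨e1, e2, e3⟩ := hpt _ k s hs
      obtain ⟨w, hw, hw'⟩ := ht2 0
      rw [hs] at hw
      exact ⟨w, by rw [e1]; exact hB k s hw, e2.trans hw'.1, hw'.2.trans e3⟩
    | succ n => exact ⟨t n, ht1 n, ht2 n⟩
  choose u hu1 hu2 using h3
  have h4 : ∀ n, u (n+1) = t n := by
    intro n
    have := hu1 (n+1)
    rw [show n + 1 + 1 = n + 2 from rfl, ht1 n] at this
    simpa using this.symm
  have h5 : ∀ n, u n = pt (u (n+1)) := by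
    intro n
    have := hu1 n
    rw [ht4 n, ← h4 n] at this
    simpa using this.symm
  have h6 : ∀ n, ∃ k, (u (n+1)).1.1 = k :: (u n).1.1 := by
    intro n
    have hne : (u (n+1)).1.1 ≠ [] := by rw [h4]; exact ht3 n
    obtain ⟨k, s, hs⟩ := List.exists_cons_of_ne_nil hne
    have := (hpt _ k s hs).1
    rw [← h5] at this
    exact ⟨k, by rw [hs, this]⟩
  choose σ hσ using h6
  have h0 : (u 0).1.1 = [] := by
    have := hd 1
    rw [show (1:ℕ) = 0 + 1 from rfl, hu1 0] at this
    simp only [nd, if_pos (hu2 0)] at this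
    exact List.eq_nil_of_length_eq_zero (by omega)
  have hres : ∀ n, (u n).1.1 = PiNat.res σ n := by
    intro n
    induction n with
    | zero => rw [h0]; rfl
    | succ n ih => rw [hσ n, ih]; rfl
  choose z hz1 hz2 using hu2
  refine ⟨σ, z, fun n => by rw [← hres]; exact hz1 n, fun n => ?_⟩
  have e1 := hy (n+1)
  rw [hu1 n] at e1
  have e2 : y ∈ Icc (u n).1.2.1 (u n).1.2.2 := e1
  have e3 := (u n).2.2.1.2.2.2
  have e4 : (1/2:ℝ)^(Encodable.encode (u n).1.1) ≤ (1/2:ℝ)^n := by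
    refine pow_le_pow_of_le_one (by norm_num) (by norm_num) ?_
    have := len_le_enc (u n).1.1
    rw [hres, PiNat.res_length] at this
    rw [hres]; exact this
  have e5 := hz2 n
  rw [abs_le]
  constructor <;> linarith [e5.1, e5.2, e2.1, e2.2]

lemma branch_forw (y : ℝ) (hU : ∀ m, y ∈ L.U m) (hy : y ∈ Icc (0:ℝ) 1) (Sg : Set (ℕ → ℕ))
    (hSg : ∀ σ ∈ Sg, ∀ n, y ∈ B (PiNat.res σ n)) :
    #Sg ≤ #((L.mkTree Fl B pt hFl hB hpt).Branch y) := by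
  have key : ∀ s : List ℕ, ∃ t : L.Tl, t.1.1 = s ∧ y ∈ Ico t.1.2.1 t.1.2.2 := by
    intro s
    obtain ⟨p, q, h1, h2⟩ := (L.tileR_iff (Encodable.encode s) y).1 (L.hUok _ y (hU _)).1
    exact ⟨⟨⟨s, p, q⟩, h1⟩, rfl, h2⟩
  choose t ht1 ht2 using key
  have hpar : ∀ k s, pt (t (k :: s)) = t s := by
    intro k s
    obtain ⟨e1, e2, e3⟩ := hpt (t (k :: s)) k s (ht1 _)
    have e4 : L.IsTile (Encodable.encode (pt (t (k :: s))).1.1) _ _ := (pt (t (k :: s))).2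
    have e5 : L.IsTile (Encodable.encode (t s).1.1) _ _ := (t s).2
    rw [e1] at e4
    rw [ht1] at e5
    have h1 := ht2 (k :: s)
    have h2 := ht2 s
    have := L.tile_uniq e4 e5 ((e2.trans h1.1).trans_lt h2.2) (h2.1.trans_lt (h1.2.trans_le e3))
    apply Subtype.ext
    exact Prod.ext (by rw [e1, ht1]) (Prod.ext this.1 this.2)
  let β : (ℕ → ℕ) → ℕ → Option (Fl ⊕ L.Tl) := fun σ n =>
    Nat.casesOn n none (fun n => some (Sum.inr (t (PiNat.res σ n))))
  have hβs : ∀ σ n, β σ (n+1) = some (Sum.inr (t (PiNat.res σ n))) := fun _ _ => rfl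
  have hm : ∀ σ ∈ Sg, ∀ n, L.Meets B (t (PiNat.res σ n)) := by
    intro σ hσ n
    exact ⟨y, by rw [ht1]; exact hSg σ hσ n, Ico_subset_Icc_self (ht2 _)⟩
  have hβ : ∀ σ ∈ Sg, β σ ∈ (L.mkTree Fl B pt hFl hB hpt).Branch y := by
    intro σ hσ n
    refine ⟨?_, ?_, ?_⟩
    · change L.nd Fl B (β σ n) = n
      cases n with
      | zero => rfl
      | succ n => rw [hβs]; simp only [nd, if_pos (hm σ hσ n)]; rw [ht1, PiNat.res_length]
    · change L.npar Fl B pt (β σ (n+1)) = β σ n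
      rw [hβs]
      cases n with
      | zero =>
        simp only [npar]
        rw [if_neg]
        · rfl
        · rintro ⟨_, h⟩
          exact h (ht1 _)
      | succ n =>
        simp only [npar]
        rw [if_pos ⟨hm σ hσ _, by rw [ht1]; simp⟩, hβs]
        rw [PiNat.res_succ, hpar]
    · change y ∈ Icc (L.na Fl (β σ n)) (L.nb Fl (β σ n))
      cases n with
      | zero => exact hy
      | succ n => exact Ico_subset_Icc_self (ht2 _)
  refine Cardinal.mk_le_of_injective (f := fun σ : Sg => (⟨β σ.1, hβ σ.1 σ.2⟩ :
    (L.mkTree Fl B pt hFl hB hpt).Branch y)) ?_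
  intro σ τ h
  have h : β σ.1 = β τ.1 := congrArg Subtype.val h
  apply Subtype.ext
  apply PiNat.res_injective
  funext n
  have := congrFun h (n+1)
  rw [hβs, hβs] at this
  have : t (PiNat.res σ.1 n) = t (PiNat.res τ.1 n) := by simpa using this
  rw [← ht1 (PiNat.res σ.1 n), ← ht1 (PiNat.res τ.1 n), this]

end LD

lemma exists_B (A : Set ℝ) (hA : MeasureTheory.AnalyticSet A) :
    ∃ B : List ℕ → Set ℝ, (∀ k s, B (k :: s) ⊆ B s) ∧
      (∀ (σ : ℕ → ℕ) (z : ℕ → ℝ) (y : ℝ), (∀ n, z n ∈ B (PiNat.res σ n)) →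
        (∀ n, |z n - y| ≤ (1/2:ℝ)^n) → y ∈ A) ∧
      (∀ y ∈ A, ∃ Sg : Set (ℕ → ℕ), 𝔠 ≤ #Sg ∧ ∀ σ ∈ Sg, ∀ n, y ∈ B (PiNat.res σ n)) := by
  rw [MeasureTheory.AnalyticSet] at hA
  rcases hA with rfl | ⟨g0, hg0, rfl⟩
  · exact ⟨fun _ => ∅, fun _ _ => Subset.rfl, fun σ z y h => absurd (h 0) (by simp), fun y hy => absurd hy (by simp)⟩
  let g : (ℕ → ℕ) → ℝ := fun σ => g0 (fun n => (Nat.unpair (σ n)).1)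
  have hg : Continuous g := by
    refine hg0.comp (continuous_pi (fun n => ?_))
    exact (continuous_of_discreteTopology (f := fun k : ℕ => (Nat.unpair k).1)).comp (continuous_apply n)
  refine ⟨fun s => g '' {σ | PiNat.res σ s.length = s}, ?_, ?_, ?_⟩
  · rintro k s _ ⟨σ, hσ, rfl⟩
    refine ⟨σ, ?_, rfl⟩
    simp only [mem_ofPred_eq, List.length_cons, PiNat.res_succ, List.cons.injEq] at hσ
    exact hσ.2
  · intro σ z y hz hzy
    choose τ hτ1 hτ2 using hz
    have h1 : Filter.Tendsto τ Filter.atTop (nhds σ) := by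
      rw [tendsto_pi_nhds]
      intro k
      refine tendsto_const_nhds.congr' ?_
      filter_upwards [Filter.eventually_gt_atTop k] with n hn
      have := hτ1 n
      simp only [mem_ofPred_eq, PiNat.res_length] at this
      exact (PiNat.res_eq_res.1 this hn).symm
    have h2 : Filter.Tendsto z Filter.atTop (nhds (g σ)) := by
      have := (hg.tendsto σ).comp h1
      refine this.congr (fun n => hτ2 n)
    have h3 : Filter.Tendsto z Filter.atTop (nhds y) := by
      rw [tendsto_iff_dist_tendsto_zero]
      refine squeeze_zero (fun n => dist_nonneg) (fun n => by rw [Real.dist_eq]; exact hzy n)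
        (tendsto_pow_atTop_nhds_zero_of_lt_one (by norm_num) (by norm_num))
    rw [tendsto_nhds_unique h3 h2]
    exact mem_range_self _
  · rintro _ ⟨τ, rfl⟩
    refine ⟨range (fun (ρ : ℕ → ℕ) (n : ℕ) => Nat.pair (τ n) (ρ n)), ?_, ?_⟩
    · rw [Cardinal.mk_range_eq]
      · simp
      · intro ρ ρ' h
        funext n
        have := congrFun h n
        exact (Nat.pair_eq_pair.1 this).2
    · rintro _ ⟨ρ, rfl⟩ n
      refine ⟨fun n => Nat.pair (τ n) (ρ n), ?_, ?_⟩
      · simp only [mem_ofPred_eq, PiNat.res_length]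
      · simp [g]

lemma flat_end (F : ℝ → ℝ) (hF : Continuous F) (hm : MapsTo F (Icc 0 1) (Icc 0 1)) (h0 : F 0 = 0) (h1 : F 1 = 1) :
    ∃ G : ℝ → ℝ, Continuous G ∧ MapsTo G (Icc 0 1) (Icc 0 1) ∧ G 0 = 0 ∧ G 1 = 1 ∧
      𝔠 ≤ #(Sec G 1) ∧ ∀ y, y ≠ 1 → #(Sec G y) = #(Sec F y) := by
  refine ⟨fun x => F (min (2 * x) 1), by fun_prop, ?_, by simp [h0], by norm_num [h1], ?_, ?_⟩
  · intro x hx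
    exact hm ⟨le_min (by linarith [hx.1]) zero_le_one, min_le_right _ _⟩
  · rw [← Cardinal.mk_Icc_real (show (1/2:ℝ) < 1 by norm_num)]
    refine Cardinal.mk_le_mk_of_subset ?_
    intro x hx
    refine ⟨⟨by linarith [hx.1], hx.2⟩, ?_⟩
    simp only
    rw [min_eq_right (by linarith [hx.1]), h1]
  · intro y hy
    have : Sec F y = (fun x => 2 * x) '' (Sec (fun x => F (min (2 * x) 1)) y) := by
      ext x
      constructor
      · rintro ⟨hx, hxy⟩
        refine ⟨x / 2, ⟨⟨by linarith [hx.1], by linarith [hx.2]⟩, ?_⟩, by ring⟩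
        simp only
        rw [mul_div_cancel₀ _ (two_ne_zero), min_eq_left hx.2, hxy]
      · rintro ⟨w, ⟨hw, hwy⟩, rfl⟩
        simp only at hwy
        have hle : 2 * w ≤ 1 := by
          by_contra hc
          rw [min_eq_right (not_le.1 hc).le, h1] at hwy
          exact hy hwy.symm
        rw [min_eq_left hle] at hwy
        exact ⟨⟨by linarith [hw.1], hle⟩, hwy⟩
    rw [this, Cardinal.mk_image_eq (mul_right_injective₀ (two_ne_zero))]

lemma sec_le (F : ℝ → ℝ) (y : ℝ) : #(Sec F y) ≤ 𝔠 := by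
  rw [← Cardinal.mk_real]; exact Cardinal.mk_set_le _

theorem suff (f : ℝ → Cardinal) (hf : ∀ y ∈ Icc (0:ℝ) 1, (1 ≤ f y ∧ f y ≤ ℵ₀) ∨ f y = 𝔠)
    (hc : Cond1 f) (hw : ∀ y ∈ Icc (0:ℝ) 1, f y = ℵ₀ → CondStar f y)
    (S : Set ℝ) (hS : S.Countable) (hSf : S ⊆ {y | f y = 𝔠})
    (hSc : ∀ y ∈ Icc (0:ℝ) 1, f y = 𝔠 → y ∉ S → CondStar f y)
    (hA : MeasureTheory.AnalyticSet {y | y ∈ Icc (0:ℝ) 1 ∧ f y = 𝔠}) :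
    ∃ F : ℝ → ℝ, ContinuousOn F (Icc 0 1) ∧ MapsTo F (Icc 0 1) (Icc 0 1) ∧ F 0 = 0 ∧ F 1 = 1 ∧
        ∀ y ∈ Icc (0:ℝ) 1, #(Sec F y) = f y := by
  obtain ⟨U, S', ro, lo, h1, h2, h3, h4, h5, h6, h7, h8, h9, h10, h11, h12⟩ :=
    layers f hf hc hw S hS hSc hSf
  obtain ⟨L, rfl, rfl, rfl⟩ := exists_LD U ro lo h1 h2 h3 h6 h7 h8 h9 h10
  have hA' : MeasureTheory.AnalyticSet ({y | y ∈ Icc (0:ℝ) 1 ∧ f y = 𝔠} ∩ S'ᶜ) := by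
    rw [Set.inter_eq_iInter]
    refine MeasureTheory.AnalyticSet.iInter (fun b => ?_)
    cases b
    · exact h4.measurableSet.compl.analyticSet
    · exact hA
  obtain ⟨B, hB, hB1, hB2⟩ := exists_B _ hA'
  obtain ⟨pt, hpt⟩ := L.exists_pt
  let Fl : Set ℝ := {y | y ∈ S' ∧ y ≠ 1}
  have hFl : ∀ y ∈ Fl, y ∈ Ico (0:ℝ) 1 := fun y hy =>
    ⟨(h5 y hy.1).1.1, lt_of_le_of_ne (h5 y hy.1).1.2 hy.2⟩
  have : Countable Fl := (h4.mono (fun y hy => hy.1)).to_subtype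
  obtain ⟨F, F1, F2, F3, F4, F5, F6, F7⟩ := (L.mkTree Fl B pt hFl hB hpt).realize
  have key : ∀ y ∈ Icc (0:ℝ) 1, y ≠ 1 ∨ y ∉ S' → #(Sec F y) = f y := by
    intro y hy hor
    by_cases hs : y ∈ S'
    · have hy1 : y ≠ 1 := by tauto
      rw [(h5 y hs).2]
      exact le_antisymm (sec_le F y) (F5 y (some (Sum.inl ⟨y, hs, hy1⟩)) rfl rfl)
    rcases hf y hy with hfy | hfy
    · rw [h12 y hy hfy.2, F7 y hy, L.up_card, L.dn_card]
      · rintro (_ | z | t) ⟨e1, e2⟩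
        · have e1 : (0:ℝ) = y := e1
          have e2 : (1:ℝ) = y := e2
          linarith
        · have e1 : (z:ℝ) = y := e1
          exact hs (e1 ▸ z.2.1)
        · have e1 : t.1.2.1 = y := e1
          have e2 : t.1.2.2 = y := e2
          have := L.tile_lt t.2
          linarith
      · intro β hβ
        obtain ⟨σ, z, hz1, hz2⟩ := L.branch_back Fl B pt hFl hB hpt y β hβ
        have := (hB1 σ z y hz1 hz2).1.2
        rw [this] at hfy
        exact absurd hfy.2 (not_le.2 Cardinal.aleph0_lt_continuum)
    · rw [hfy]
      refine le_antisymm (sec_le F y) ?_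
      obtain ⟨Sg, hSg1, hSg2⟩ := hB2 y ⟨⟨hy, hfy⟩, hs⟩
      exact hSg1.trans ((L.branch_forw Fl B pt hFl hB hpt y (h11 y hy hfy hs) hy Sg hSg2).trans (F6 y))
  by_cases h1S : (1:ℝ) ∈ S'
  · obtain ⟨G, G1, G2, G3, G4, G5, G6⟩ := flat_end F F1 F2 F3 F4
    refine ⟨G, G1.continuousOn, G2, G3, G4, fun y hy => ?_⟩
    by_cases hy1 : y = 1
    · subst hy1
      rw [(h5 _ h1S).2]
      exact le_antisymm (sec_le G 1) G5
    · rw [G6 y hy1]; exact key y hy (Or.inl hy1)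
  · refine ⟨F, F1.continuousOn, F2, F3, F4, fun y hy => key y hy ?_⟩
    by_cases hy1 : y = 1
    · right; rw [hy1]; exact h1S
    · exact Or.inl hy1

theorem indicatrix_characterization (f : ℝ → Cardinal)
    (hf : ∀ y ∈ Set.Icc (0:ℝ) 1, (1 ≤ f y ∧ f y ≤ ℵ₀) ∨ f y = Cardinal.continuum) :
    (∃ F : ℝ → ℝ, ContinuousOn F (Set.Icc 0 1) ∧
        Set.MapsTo F (Set.Icc 0 1) (Set.Icc 0 1) ∧ F 0 = 0 ∧ F 1 = 1 ∧
        ∀ y ∈ Set.Icc (0:ℝ) 1, #(Sec F y) = f y) ↔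
      (Cond1 f ∧
        ((∀ y ∈ Set.Icc (0:ℝ) 1, f y = ℵ₀ → CondStar f y) ∧
          ∃ S : Set ℝ, S.Countable ∧ S ⊆ {y | f y = Cardinal.continuum} ∧
            ∀ y ∈ Set.Icc (0:ℝ) 1, f y = Cardinal.continuum → y ∉ S → CondStar f y) ∧
        MeasureTheory.AnalyticSet {y | y ∈ Set.Icc (0:ℝ) 1 ∧ f y = Cardinal.continuum}) := by
  constructor
  · rintro ⟨F, hF, hm, h0, h1, hs⟩
    refine ⟨nec_cond1 f F hF hm h0 h1 hs, ⟨fun y hy hfy => ?_, ?_⟩, ?_⟩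
    · refine nec_star f F hF hm h0 h1 hs y hy hfy.ge (noInt_of_le F y ?_)
      rw [hs y hy, hfy]
    · refine ⟨{y | (y ∈ Icc (0:ℝ) 1 ∧ f y = 𝔠) ∧ ¬ NoInt F y}, (nec_S F).mono (fun y hy => hy.2),
        fun y hy => hy.1.2, fun y hy hfy hyS => ?_⟩
      refine nec_star f F hF hm h0 h1 hs y hy (by rw [hfy]; exact Cardinal.aleph0_le_continuum) ?_
      by_contra hno
      exact hyS ⟨⟨hy, hfy⟩, hno⟩
    · convert nec_analytic F hF using 1
      ext y
      simp only [mem_ofPred_eq]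
      rw [← Cardinal.le_aleph0_iff_set_countable]
      constructor
      · rintro ⟨hy, hfy⟩ hle
        rw [hs y hy, hfy] at hle
        exact absurd hle (not_le.2 Cardinal.aleph0_lt_continuum)
      · intro hnc
        have hy : y ∈ Icc (0:ℝ) 1 := by
          by_contra hy
          apply hnc
          have : Sec F y = ∅ := by
            ext x
            simp only [mem_empty_iff_false, iff_false]
            rintro ⟨hx, rfl⟩
            exact hy (hm hx)
          rw [this]; simp
        refine ⟨hy, ?_⟩
        rcases hf y hy with h | h
        · rw [hs y hy] at hnc
          exact absurd h.2 hnc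
        · exact h
  · rintro ⟨hc, ⟨hw, S, hS, hSf, hSc⟩, hA⟩
    exact suff f hf hc hw S hS hSf hSc hA
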